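/- arXiv:2202.12625 — 2 statements merged into one kernel-verified Lean document; each statement's English description precedes it below -/
import Mathlib

section
/- Let $(D, \nu)$ be a probability space, let $\eta_1, \dots, \eta_m : D \to \mathbb{C}$ be bounded measurable functions, orthonormal in $L_2(D, \nu)$, spanning $V_m := \mathrm{span}\{\eta_1, \dots, \eta_m\}$, with $m \ge 10$. Let $p, t \in (0,1)$, $b \ge 1 + \frac{10}{m}$, and $M \in \mathbb{N}$ with $M \ge \frac{4}{t^2} m \log(\frac{m}{p})$ and $M \ge \lceil bm \rceil$. Draw nodes $\tilde{x}^1, \dots, \tilde{x}^M \in D$ i.i.d. according to the probability measure $d\mu := \varphi\, d\nu$ with $\varphi(x) := \frac{1}{2} + \frac{1}{2m} \sum_{k=1}^m |\eta_k(x)|^2$. Then with probability exceeding $1 - p$ the following holds: there exist $n \le \lceil bm \rceil$ and a subsequence $x^1, \dots, x^n$ of $\tilde{x}^1, \dots, \tilde{x}^M$ such that for all $f \in V_m$: $\|f\|_{L_2(D,\nu)}^2 \le \frac{2}{M(1-t)} \sum_{i=1}^M |f(\tilde{x}^i)|^2 \le \frac{432\, b^3}{(b-1)^3 (1-t)} \cdot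 \frac{1}{m} \sum_{i=1}^n |f(x^i)|^2$. -/
open MeasureTheory

section SpectralForm

open Matrix
open scoped ComplexOrder

variable {ι : Type*} [Fintype ι]

theorem trace_mul_vecMulVec_star (B : Matrix ι ι ℂ) (v : ι → ℂ) :
    (B * vecMulVec v (star v)).trace = star v ⬝ᵥ B *ᵥ v := by
  rw [mul_vecMulVec, trace_vecMulVec, dotProduct_comm]

variable [DecidableEq ι]

/-- The matrix with eigenvalues `d` and eigenvectors the columns of `U`. -/
noncomputable def spectralMatrix (U : Matrix ι ι ℂ) (d : ι → ℝ) : Matrix ι ι ℂ :=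
  U * diagonal (fun i => (d i : ℂ)) * Uᴴ

theorem Matrix.IsHermitian.exists_eq_spectralMatrix {A : Matrix ι ι ℂ} (hA : A.IsHermitian) :
    ∃ (U : Matrix ι ι ℂ) (d : ι → ℝ), Uᴴ * U = 1 ∧ U * Uᴴ = 1 ∧ A = spectralMatrix U d := by
  refine ⟨hA.eigenvectorUnitary, hA.eigenvalues, ?_, ?_, ?_⟩
  · rw [← star_eq_conjTranspose]
    exact Unitary.coe_star_mul_self hA.eigenvectorUnitary
  · rw [← star_eq_conjTranspose]
    exact Unitary.coe_mul_star_self hA.eigenvectorUnitary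
  · exact hA.spectral_theorem

theorem spectralMatrix_mul {U : Matrix ι ι ℂ} (hU : Uᴴ * U = 1) (d e : ι → ℝ) :
    spectralMatrix U d * spectralMatrix U e = spectralMatrix U (fun i => d i * e i) := by
  unfold spectralMatrix
  calc _ = U * diagonal (fun i => (d i : ℂ)) * (Uᴴ * U) * diagonal (fun i => (e i : ℂ)) * Uᴴ := by
        simp only [Matrix.mul_assoc]
    _ = _ := by
        rw [hU, Matrix.mul_one, Matrix.mul_assoc U, diagonal_mul_diagonal]
        simp

theorem spectralMatrix_const {U : Matrix ι ι ℂ} (hU : U * Uᴴ = 1) (c : ℝ) :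
    spectralMatrix U (fun _ => c) = (c : ℂ) • (1 : Matrix ι ι ℂ) := by
  have : diagonal (fun _ : ι => (c : ℂ)) = (c : ℂ) • (1 : Matrix ι ι ℂ) := by
    ext i j
    by_cases h : i = j <;> simp [h]
  simp [spectralMatrix, this, hU]

theorem spectralMatrix_sub (U : Matrix ι ι ℂ) (d e : ι → ℝ) :
    spectralMatrix U d - spectralMatrix U e = spectralMatrix U (fun i => d i - e i) := by
  unfold spectralMatrix
  rw [← Matrix.sub_mul, ← Matrix.mul_sub, diagonal_sub]
  simp

theorem trace_spectralMatrix {U : Matrix ι ι ℂ} (hU : Uᴴ * U = 1) (d : ι → ℝ) :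
    (spectralMatrix U d).trace = ((∑ i, d i : ℝ) : ℂ) := by
  unfold spectralMatrix
  rw [Matrix.trace_mul_cycle, hU, Matrix.one_mul, trace_diagonal]
  simp

theorem isHermitian_spectralMatrix (U : Matrix ι ι ℂ) (d : ι → ℝ) :
    (spectralMatrix U d).IsHermitian := by
  unfold spectralMatrix
  apply isHermitian_mul_mul_conjTranspose
  rw [isHermitian_diagonal_iff]
  intro i
  simp [IsSelfAdjoint]

theorem posDef_spectralMatrix_iff {U : Matrix ι ι ℂ} (hU : U * Uᴴ = 1) (d : ι → ℝ) :
    (spectralMatrix U d).PosDef ↔ ∀ i, 0 < d i := by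
  unfold spectralMatrix
  have hunit : IsUnit U := IsUnit.of_mul_eq_one _ hU
  rw [← star_eq_conjTranspose, hunit.posDef_star_right_conjugate_iff, posDef_diagonal_iff]
  simp

theorem star_dotProduct_spectralMatrix_mulVec (U : Matrix ι ι ℂ) (d : ι → ℝ) (y : ι → ℂ) :
    star y ⬝ᵥ spectralMatrix U d *ᵥ y = ((∑ i, d i * ‖(Uᴴ *ᵥ y) i‖ ^ 2 : ℝ) : ℂ) := by
  have h : star y ⬝ᵥ spectralMatrix U d *ᵥ y
      = star (Uᴴ *ᵥ y) ⬝ᵥ (diagonal (fun i => (d i : ℂ)) *ᵥ (Uᴴ *ᵥ y)) := by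
    rw [spectralMatrix, star_mulVec, conjTranspose_conjTranspose, ← dotProduct_mulVec,
      mulVec_mulVec, mulVec_mulVec]
  rw [h, dotProduct]
  push_cast
  refine Finset.sum_congr rfl fun i _ => ?_
  rw [mulVec_diagonal, ← Complex.conj_mul']
  simp only [Pi.star_apply, RCLike.star_def]
  ring

theorem inv_spectralMatrix {U : Matrix ι ι ℂ} (hU : Uᴴ * U = 1) (hU' : U * Uᴴ = 1) {d : ι → ℝ}
    (hd : ∀ i, d i ≠ 0) : (spectralMatrix U d)⁻¹ = spectralMatrix U (fun i => (d i)⁻¹) := by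
  apply Matrix.inv_eq_right_inv
  rw [spectralMatrix_mul hU]
  simp only [mul_inv_cancel₀ (hd _)]
  rw [spectralMatrix_const hU']
  simp

/-- Sherman–Morrison for the trace of the inverse of a rank-one update. -/
theorem trace_inv_add_vecMulVec {B R : Matrix ι ι ℂ} (hBR : B * R = 1) (v : ι → ℂ)
    (hc : 1 + star v ⬝ᵥ R *ᵥ v ≠ 0) :
    ((B + vecMulVec v (star v))⁻¹).trace
      = R.trace - (1 + star v ⬝ᵥ R *ᵥ v)⁻¹ * (star v ⬝ᵥ (R * R) *ᵥ v) := by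
  set c := 1 + star v ⬝ᵥ R *ᵥ v with hcdef
  have hinv : (B + vecMulVec v (star v))⁻¹ = R - c⁻¹ • vecMulVec (R *ᵥ v) (star v ᵥ* R) := by
    apply Matrix.inv_eq_right_inv
    have hscalar : star v ⬝ᵥ R *ᵥ v = c - 1 := by rw [hcdef]; ring
    rw [Matrix.mul_sub, Matrix.add_mul, Matrix.add_mul, hBR, vecMulVec_mul, Matrix.mul_smul,
      mul_vecMulVec, mulVec_mulVec, hBR, one_mulVec, Matrix.mul_smul, vecMulVec_mul_vecMulVec,
      hscalar]
    ext i j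
    simp only [Matrix.sub_apply, Matrix.add_apply, Matrix.smul_apply, vecMulVec_apply, smul_eq_mul,
      Pi.smul_apply]
    field_simp
    ring
  rw [hinv, trace_sub, trace_smul, trace_vecMulVec, smul_eq_mul, dotProduct_comm,
    ← dotProduct_mulVec, mulVec_mulVec]

end SpectralForm

section Barrier

open Matrix
open scoped ComplexOrder

variable {ι : Type*} [Fintype ι]

/-- The averaged lower-barrier inequality, in terms of the gaps `u` to the shifted barrier. -/
theorem barrier_average_nonneg [Nonempty ι] {u : ι → ℝ} (hu : ∀ i, 0 < u i) {δ κ w N : ℝ}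
    (hδ : 0 < δ) (hκ : 0 < κ) (hw : 0 ≤ w)
    (hΦ : ∑ i, (u i + δ)⁻¹ = Fintype.card ι / κ) (hδκ : δ * Fintype.card ι ≤ κ)
    (hN : κ / δ + N ≤ w * (1 / δ - Fintype.card ι / κ)) :
    (∑ i, (u i)⁻¹ - ∑ i, (u i + δ)⁻¹) *
        (N + (w * ∑ i, (u i)⁻¹ - Fintype.card ι))
      ≤ w * ∑ i, (u i)⁻¹ * (u i)⁻¹ - ∑ i, (u i)⁻¹ := by
  have hu' : ∀ i, 0 < u i + δ := fun i => add_pos (hu i) hδ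
  set m : ℝ := (Fintype.card ι : ℝ) with hm
  have hmpos : 0 < m := by rw [hm]; exact_mod_cast Fintype.card_pos
  set S₁ := ∑ i, (u i)⁻¹ with hS1
  set S₂ := ∑ i, (u i)⁻¹ * (u i)⁻¹ with hS2
  set Φ := ∑ i, (u i + δ)⁻¹ with hPhi
  set Q := ∑ i, (u i)⁻¹ * (u i + δ)⁻¹ with hQ
  set C := ∑ i, (u i)⁻¹ * (u i)⁻¹ * (u i + δ)⁻¹ with hC
  have hQpos : 0 ≤ Q := Finset.sum_nonneg fun i _ =>
    mul_nonneg (inv_nonneg.2 (hu i).le) (inv_nonneg.2 (hu' i).le)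
  have hCpos : 0 ≤ C := Finset.sum_nonneg fun i _ =>
    mul_nonneg (mul_nonneg (inv_nonneg.2 (hu i).le) (inv_nonneg.2 (hu i).le))
      (inv_nonneg.2 (hu' i).le)
  have hdiff : S₁ - Φ = δ * Q := by
    rw [hS1, hPhi, hQ, ← Finset.sum_sub_distrib, Finset.mul_sum]
    refine Finset.sum_congr rfl fun i _ => ?_
    have := (hu i).ne'
    have := (hu' i).ne'
    field_simp
    ring
  have hS2eq : S₂ = Q + δ * C := by
    rw [hS2, hQ, hC, Finset.mul_sum, ← Finset.sum_add_distrib]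
    refine Finset.sum_congr rfl fun i _ => ?_
    have := (hu i).ne'
    have := (hu' i).ne'
    field_simp
  have hCS : Q ^ 2 ≤ C * Φ := by
    refine Finset.sum_sq_le_sum_mul_sum_of_sq_le_mul _ (fun i _ => ?_) (fun i _ => ?_)
      (fun i _ => le_of_eq ?_)
    · exact mul_nonneg (mul_nonneg (inv_nonneg.2 (hu i).le) (inv_nonneg.2 (hu i).le))
        (inv_nonneg.2 (hu' i).le)
    · exact inv_nonneg.2 (hu' i).le
    · ring
  have hcheb : S₁ * Φ ≤ m * Q := by
    refine Monovary.sum_mul_sum_le_card_mul_sum fun i j hij => ?_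
    have : u j + δ < u i + δ := (inv_lt_inv₀ (hu' i) (hu' j)).1 hij
    exact inv_anti₀ (hu j) (by linarith)
  have hS1le : S₁ ≤ κ * Q := by
    rw [hΦ, mul_div_assoc', div_le_iff₀ hκ] at hcheb
    nlinarith
  have hδΦ : δ * Φ ≤ 1 := by
    rw [hΦ, mul_div_assoc', div_le_one hκ]; exact hδκ
  have hmain : δ * Q * (1 / δ - Φ) ≤ S₂ - δ * Q * S₁ := by
    have h1 : δ * Q * (1 / δ - Φ) = Q - δ * Q * Φ := by field_simp
    have h2 : S₁ = Φ + δ * Q := by linarith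
    have h3 : δ ^ 2 * Q ^ 2 ≤ δ * C := by
      calc δ ^ 2 * Q ^ 2 ≤ δ ^ 2 * (C * Φ) := by gcongr
        _ = δ * C * (δ * Φ) := by ring
        _ ≤ δ * C * 1 := by gcongr
        _ = δ * C := mul_one _
    rw [h1, h2, hS2eq]
    nlinarith
  rw [hdiff]
  have h4 := mul_le_mul_of_nonneg_left hmain hw
  have h5 : δ * Q * (κ / δ + N) ≤ δ * Q * (w * (1 / δ - Φ)) := by
    rw [hΦ]; exact mul_le_mul_of_nonneg_left hN (mul_nonneg hδ.le hQpos)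
  have h6 : δ * Q * (κ / δ + N) = κ * Q + δ * Q * N := by field_simp
  have h7 : 0 ≤ δ * Q * m := by positivity
  nlinarith

/-- Raising a barrier until the potential `∑ (d i - l)⁻¹` attains a prescribed value. -/
theorem exists_barrier_eq [Nonempty ι] {d : ι → ℝ} {l Φ : ℝ} (hl : ∀ i, l < d i)
    (hΦ0 : 0 < Φ) (hΦ : ∑ i, (d i - l)⁻¹ ≤ Φ) :
    ∃ x, l ≤ x ∧ (∀ i, x + Φ⁻¹ ≤ d i) ∧ ∑ i, (d i - x)⁻¹ = Φ := by
  obtain ⟨i₀, hi₀⟩ := Finite.exists_min d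
  have hpos : 0 < Φ⁻¹ := inv_pos.2 hΦ0
  have hlr : l ≤ d i₀ - Φ⁻¹ := by
    have h1 : (d i₀ - l)⁻¹ ≤ Φ := le_trans
      (Finset.single_le_sum (f := fun i => (d i - l)⁻¹)
        (fun i _ => inv_nonneg.2 (sub_nonneg.2 (hl i).le)) (Finset.mem_univ i₀)) hΦ
    have h2 := inv_anti₀ (inv_pos.2 (sub_pos.2 (hl i₀))) h1
    rw [inv_inv] at h2
    linarith
  have hcont : ContinuousOn (fun x => ∑ i, (d i - x)⁻¹) (Set.Icc l (d i₀ - Φ⁻¹)) := by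
    refine continuousOn_finsetSum _ fun i _ => ContinuousOn.inv₀ (by fun_prop) fun x hx => ?_
    have := hi₀ i
    have := hx.2
    linarith
  have hend : Φ ≤ ∑ i, (d i - (d i₀ - Φ⁻¹))⁻¹ := by
    have := Finset.single_le_sum (f := fun i => (d i - (d i₀ - Φ⁻¹))⁻¹) (fun i _ => by
      have := hi₀ i
      exact inv_nonneg.2 (by linarith)) (Finset.mem_univ i₀)
    simpa using this
  obtain ⟨x, hx, hfx⟩ := intermediate_value_Icc hlr hcont ⟨hΦ, hend⟩
  refine ⟨x, hx.1, fun i => ?_, hfx⟩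
  have := hi₀ i
  have := hx.2
  linarith

theorem star_dotProduct_sum_vecMulVec_mulVec {σ : Type*} (s : Finset σ) (V : Matrix σ ι ℂ)
    (c : ι → ℂ) :
    star c ⬝ᵥ (∑ i ∈ s, vecMulVec (star (V i)) (star (star (V i)))) *ᵥ c
      = ((∑ i ∈ s, ‖(V *ᵥ c) i‖ ^ 2 : ℝ) : ℂ) := by
  rw [Matrix.sum_mulVec, dotProduct_sum]
  push_cast
  refine Finset.sum_congr rfl fun i _ => ?_
  rw [vecMulVec_mulVec, star_star, ← Complex.conj_mul']
  have h1 : (V *ᵥ c) i = V i ⬝ᵥ c := rfl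
  have h2 : star c ⬝ᵥ star (V i) = star (V i ⬝ᵥ c) := by
    rw [star_dotProduct_star, dotProduct_comm]
  simp only [dotProduct_smul, h2, h1, RCLike.star_def]
  simp [mul_comm]

variable [DecidableEq ι]

/-- Summing a quadratic form over vectors with a prescribed frame operator. -/
theorem sum_spectral_quadratic_form {σ : Type*} {U : Matrix ι ι ℂ} (hU : Uᴴ * U = 1)
    (s : Finset σ) (v : σ → ι → ℂ) (f g : ι → ℝ)
    (hsum : ∑ i ∈ s, vecMulVec (v i) (star (v i)) = spectralMatrix U g) :
    ∑ i ∈ s, ∑ j, f j * ‖(Uᴴ *ᵥ v i) j‖ ^ 2 = ∑ j, f j * g j := by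
  have h : ((∑ i ∈ s, ∑ j, f j * ‖(Uᴴ *ᵥ v i) j‖ ^ 2 : ℝ) : ℂ)
      = ((∑ j, f j * g j : ℝ) : ℂ) := by
    rw [← trace_spectralMatrix hU, ← spectralMatrix_mul hU, ← hsum, Matrix.mul_sum, trace_sum,
      Complex.ofReal_sum]
    refine Finset.sum_congr rfl fun i _ => ?_
    rw [trace_mul_vecMulVec_star, star_dotProduct_spectralMatrix_mulVec]
  exact_mod_cast h

/-- One step of the unweighted lower-barrier selection: either the barrier has already reached
`L`, or one of the remaining vectors lets the barrier move up by `δ` without increasing the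
potential. -/
theorem exists_barrier_step [Nonempty ι] {σ : Type*} {A : Matrix ι ι ℂ} (hA : A.IsHermitian)
    {s : Finset σ} (hs : s.Nonempty) (v : σ → ι → ℂ)
    (hsum : ∑ i ∈ s, vecMulVec (v i) (star (v i)) = 1 - A) {l δ κ L : ℝ} (hδ : 0 < δ)
    (hκ : 0 < κ) (hL : L ≤ 1) (hδκ : δ * Fintype.card ι < κ)
    (hN : κ / δ + s.card ≤ (1 - L) * (1 / δ - Fintype.card ι / κ))
    (hpd : (A - (l : ℂ) • (1 : Matrix ι ι ℂ)).PosDef)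
    (hΦ : ((A - (l : ℂ) • (1 : Matrix ι ι ℂ))⁻¹).trace.re ≤ Fintype.card ι / κ) :
    (A - (L : ℂ) • (1 : Matrix ι ι ℂ)).PosDef ∨ ∃ i ∈ s, ∃ l', l + δ ≤ l' ∧
      (A + vecMulVec (v i) (star (v i)) - (l' : ℂ) • (1 : Matrix ι ι ℂ)).PosDef ∧
      ((A + vecMulVec (v i) (star (v i)) - (l' : ℂ) • (1 : Matrix ι ι ℂ))⁻¹).trace.re
        ≤ Fintype.card ι / κ := by
  obtain ⟨U, d, hU, hU', rfl⟩ := hA.exists_eq_spectralMatrix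
  have hshift : ∀ x : ℝ, spectralMatrix U d - (x : ℂ) • (1 : Matrix ι ι ℂ)
      = spectralMatrix U (fun i => d i - x) := fun x => by
    rw [← spectralMatrix_const hU', spectralMatrix_sub]
  have hcard : (0 : ℝ) < Fintype.card ι := by exact_mod_cast Fintype.card_pos
  rw [hshift, posDef_spectralMatrix_iff hU'] at hpd
  rw [hshift, inv_spectralMatrix hU hU' (fun i => (hpd i).ne'), trace_spectralMatrix hU,
    Complex.ofReal_re] at hΦ
  obtain ⟨x, hlx, hxd, hxΦ⟩ := exists_barrier_eq (fun i => sub_pos.1 (hpd i))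
    (div_pos hcard hκ) hΦ
  rw [inv_div] at hxd
  have hδκ' : δ < κ / Fintype.card ι := (lt_div_iff₀ hcard).2 hδκ
  have hu : ∀ i, 0 < d i - (x + δ) := fun i => by have := hxd i; linarith
  by_cases hLx : L < x + δ
  · left
    rw [hshift, posDef_spectralMatrix_iff hU']
    intro i
    have := hu i
    linarith
  right
  push Not at hLx
  set u : ι → ℝ := fun i => d i - (x + δ) with hudef
  replace hu : ∀ i, 0 < u i := hu
  have hΦu : ∑ i, (u i + δ)⁻¹ = Fintype.card ι / κ := by
    rw [← hxΦ]
    refine Finset.sum_congr rfl fun i _ => ?_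
    simp only [hudef]; ring_nf
  have hgap : 0 ≤ 1 / δ - Fintype.card ι / κ := by
    rw [sub_nonneg, div_le_div_iff₀ hκ hδ]
    linarith
  have havg := barrier_average_nonneg hu hδ hκ (w := 1 - (x + δ)) (N := s.card) (by linarith)
    hΦu hδκ.le (hN.trans (mul_le_mul_of_nonneg_right (by linarith) hgap))
  set Δ := ∑ i, (u i)⁻¹ - ∑ i, (u i + δ)⁻¹ with hΔ
  have hsum' : ∑ i ∈ s, vecMulVec (v i) (star (v i))
      = spectralMatrix U (fun i => (1 - (x + δ)) - u i) := by
    rw [hsum]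
    have h1 : (1 : Matrix ι ι ℂ) = spectralMatrix U (fun _ => 1) := by
      rw [spectralMatrix_const hU']; simp
    conv_lhs => rw [h1, spectralMatrix_sub]
    congr 1
    funext i
    rw [hudef]; ring
  set q₁ : σ → ℝ := fun i => ∑ j, (u j)⁻¹ * ‖(Uᴴ *ᵥ v i) j‖ ^ 2 with hq1
  set q₂ : σ → ℝ := fun i => ∑ j, (u j)⁻¹ * (u j)⁻¹ * ‖(Uᴴ *ᵥ v i) j‖ ^ 2 with hq2
  have hs1 : ∑ i ∈ s, q₁ i = (1 - (x + δ)) * ∑ i, (u i)⁻¹ - Fintype.card ι := by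
    rw [hq1, sum_spectral_quadratic_form hU s v _ _ hsum', Finset.mul_sum,
      ← Finset.card_univ, Finset.cast_card, ← Finset.sum_sub_distrib]
    refine Finset.sum_congr rfl fun i _ => ?_
    have := (hu i).ne'
    field_simp
  have hs2 : ∑ i ∈ s, q₂ i
      = (1 - (x + δ)) * ∑ i, (u i)⁻¹ * (u i)⁻¹ - ∑ i, (u i)⁻¹ := by
    rw [hq2, sum_spectral_quadratic_form hU s v (fun j => (u j)⁻¹ * (u j)⁻¹) _ hsum',
      Finset.mul_sum, ← Finset.sum_sub_distrib]
    refine Finset.sum_congr rfl fun i _ => ?_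
    have := (hu i).ne'
    field_simp
  obtain ⟨i, his, hi⟩ : ∃ i ∈ s, Δ * (1 + q₁ i) ≤ q₂ i := by
    refine Finset.exists_le_of_sum_le hs ?_
    rw [← Finset.mul_sum, Finset.sum_add_distrib, hs1, hs2, Finset.sum_const, nsmul_eq_mul,
      mul_one]
    exact havg
  refine ⟨i, his, x + δ, by linarith, ?_, ?_⟩
  · rw [add_sub_right_comm, hshift]
    exact ((posDef_spectralMatrix_iff hU' _).2 hu).add_posSemidef
      (posSemidef_vecMulVec_self_star _)
  · have hq1nonneg : 0 ≤ q₁ i := Finset.sum_nonneg fun j _ =>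
      mul_nonneg (inv_nonneg.2 (hu j).le) (sq_nonneg _)
    have hBR : spectralMatrix U u * spectralMatrix U (fun j => (u j)⁻¹) = 1 := by
      rw [spectralMatrix_mul hU]
      simp only [mul_inv_cancel₀ (hu _).ne']
      rw [spectralMatrix_const hU']
      simp
    rw [add_sub_right_comm, hshift]
    have hform : star (v i) ⬝ᵥ spectralMatrix U (fun j => (u j)⁻¹) *ᵥ v i = (q₁ i : ℂ) :=
      star_dotProduct_spectralMatrix_mulVec _ _ _
    have hform2 : star (v i) ⬝ᵥ (spectralMatrix U (fun j => (u j)⁻¹) *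
        spectralMatrix U (fun j => (u j)⁻¹)) *ᵥ v i = (q₂ i : ℂ) := by
      rw [spectralMatrix_mul hU]
      exact star_dotProduct_spectralMatrix_mulVec _ _ _
    rw [trace_inv_add_vecMulVec hBR, hform, hform2, trace_spectralMatrix hU]
    · norm_cast
      have : Δ ≤ (1 + q₁ i)⁻¹ * q₂ i := by
        rw [inv_mul_eq_div, le_div_iff₀ (by linarith)]
        exact hi
      rw [← hΦu]
      linarith
    · rw [hform]
      norm_cast
      linarith

/-- Lower-barrier subset selection for a Parseval frame. -/
theorem exists_subset_frame_lower_bound [Nonempty ι] {σ : Type*} [Fintype σ] [DecidableEq σ]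
    (v : σ → ι → ℂ) (hv : ∑ i, vecMulVec (v i) (star (v i)) = 1) {n : ℕ}
    (hn : n ≤ Fintype.card σ) {δ κ L : ℝ} (hδ : 0 < δ) (hκ : 0 < κ) (hL : L ≤ 1)
    (hδκ : δ * Fintype.card ι < κ)
    (hN : κ / δ + Fintype.card σ ≤ (1 - L) * (1 / δ - Fintype.card ι / κ))
    (hend : L ≤ -κ + n * δ) :
    ∃ J : Finset σ, J.card ≤ n ∧
      (∑ i ∈ J, vecMulVec (v i) (star (v i)) - (L : ℂ) • (1 : Matrix ι ι ℂ)).PosSemidef := by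
  have key : ∀ k ≤ n, ∃ J : Finset σ, J.card ≤ k ∧
      ((∑ i ∈ J, vecMulVec (v i) (star (v i)) - (L : ℂ) • (1 : Matrix ι ι ℂ)).PosSemidef ∨
      ∃ l : ℝ, -κ + k * δ ≤ l ∧
        (∑ i ∈ J, vecMulVec (v i) (star (v i)) - (l : ℂ) • (1 : Matrix ι ι ℂ)).PosDef ∧
        ((∑ i ∈ J, vecMulVec (v i) (star (v i)) - (l : ℂ) • (1 : Matrix ι ι ℂ))⁻¹).trace.re
          ≤ Fintype.card ι / κ) := by
    intro k
    induction k with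
    | zero =>
      intro _
      refine ⟨∅, by simp, Or.inr ⟨-κ, by simp, ?_, ?_⟩⟩
      · have : ((κ : ℂ) • (1 : Matrix ι ι ℂ)).PosDef :=
          PosDef.one.smul (by exact_mod_cast hκ)
        simpa using this
      · have : ((κ : ℂ) • (1 : Matrix ι ι ℂ))⁻¹ = (κ⁻¹ : ℂ) • (1 : Matrix ι ι ℂ) := by
          apply Matrix.inv_eq_right_inv
          have : (κ : ℂ) ≠ 0 := by exact_mod_cast hκ.ne'
          rw [Matrix.smul_mul, Matrix.one_mul, smul_smul, mul_inv_cancel₀ this, one_smul]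
        simp only [Finset.sum_empty, Complex.ofReal_neg, neg_smul, zero_sub, neg_neg, this,
          trace_smul, trace_one, smul_eq_mul]
        norm_cast
        rw [inv_mul_eq_div]
    | succ k ih =>
      intro hk
      obtain ⟨J, hJ, h | ⟨l, hl, hpd, hΦ⟩⟩ := ih (by omega)
      · exact ⟨J, by omega, Or.inl h⟩
      have hs : (Jᶜ : Finset σ).Nonempty := by
        rw [← Finset.card_pos, Finset.card_compl]
        omega
      have hsum : ∑ i ∈ Jᶜ, vecMulVec (v i) (star (v i))
          = 1 - ∑ i ∈ J, vecMulVec (v i) (star (v i)) := by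
        rw [← hv, ← Finset.sum_add_sum_compl J, add_sub_cancel_left]
      have hA : (∑ i ∈ J, vecMulVec (v i) (star (v i))).IsHermitian :=
        (posSemidef_sum J fun i _ => posSemidef_vecMulVec_self_star (v i)).isHermitian
      have hcard : ((Jᶜ : Finset σ).card : ℝ) ≤ Fintype.card σ := by
        exact_mod_cast Finset.card_le_univ _
      rcases exists_barrier_step hA hs v hsum hδ hκ hL hδκ (by linarith) hpd hΦ with
        h | ⟨i, hi, l', hl', hpd', hΦ'⟩
      · exact ⟨J, by omega, Or.inl h.posSemidef⟩
      · have hiJ : i ∉ J := Finset.mem_compl.1 hi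
        refine ⟨insert i J, ?_, Or.inr ⟨l', ?_, ?_, ?_⟩⟩
        · rw [Finset.card_insert_of_notMem hiJ]; omega
        · push_cast; linarith
        · rw [Finset.sum_insert hiJ, add_comm (vecMulVec _ _)]; exact hpd'
        · rw [Finset.sum_insert hiJ, add_comm (vecMulVec _ _)]; exact hΦ'
  obtain ⟨J, hJ, h | ⟨l, hl, hpd, -⟩⟩ := key n le_rfl
  · exact ⟨J, hJ, h⟩
  · refine ⟨J, hJ, ?_⟩
    have h1 : (((l - L : ℝ) : ℂ) • (1 : Matrix ι ι ℂ)).PosSemidef :=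
      PosSemidef.one.smul (by exact_mod_cast sub_nonneg.2 (hend.trans hl))
    have h2 := hpd.posSemidef.add h1
    convert h2 using 1
    push_cast
    rw [sub_smul]
    abel

/-- Every frame can be turned into a Parseval frame by a change of coordinates. -/
theorem exists_parseval_coordinates {σ : Type*} [Fintype σ] (Y : Matrix σ ι ℂ)
    (hY : Function.Injective Y.mulVec) :
    ∃ (V : Matrix σ ι ℂ) (S : Matrix ι ι ℂ), Vᴴ * V = 1 ∧ Y = V * S := by
  have hG : (Yᴴ * Y).PosDef := PosDef.conjTranspose_mul_self Y hY
  obtain ⟨U, d, hU, hU', hd⟩ := hG.isHermitian.exists_eq_spectralMatrix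
  rw [hd, posDef_spectralMatrix_iff hU'] at hG
  have hsq : ∀ i, 0 < √(d i) := fun i => Real.sqrt_pos.2 (hG i)
  have hone : spectralMatrix U (fun _ => 1) = 1 := by
    rw [spectralMatrix_const hU']; simp
  refine ⟨Y * spectralMatrix U (fun i => (√(d i))⁻¹), spectralMatrix U (fun i => √(d i)), ?_, ?_⟩
  · rw [conjTranspose_mul, (isHermitian_spectralMatrix U _).eq, Matrix.mul_assoc,
      ← Matrix.mul_assoc Yᴴ, hd, spectralMatrix_mul hU, spectralMatrix_mul hU, ← hone]
    congr 1
    funext i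
    have := (hsq i).ne'
    field_simp
    exact (Real.sq_sqrt (hG i).le).symm
  · rw [Matrix.mul_assoc, spectralMatrix_mul hU]
    simp only [inv_mul_cancel₀ (hsq _).ne']
    rw [hone, Matrix.mul_one]

theorem exists_subset_sum_sq_lower_bound [Nonempty ι] {σ : Type*} [Fintype σ] [DecidableEq σ]
    (Y : Matrix σ ι ℂ) (hY : Function.Injective Y.mulVec) {b : ℝ} (hb : 1 < b)
    (hM : ⌈b * Fintype.card ι⌉₊ ≤ Fintype.card σ) :
    ∃ J : Finset σ, J.card ≤ ⌈b * Fintype.card ι⌉₊ ∧ ∀ a : ι → ℂ,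
      (Fintype.card ι / Fintype.card σ : ℝ) * ((b - 1) ^ 3 / (216 * b ^ 3)) *
        ∑ i, ‖(Y *ᵥ a) i‖ ^ 2 ≤ ∑ i ∈ J, ‖(Y *ᵥ a) i‖ ^ 2 := by
  obtain ⟨V, S, hV, rfl⟩ := exists_parseval_coordinates Y hY
  set m : ℝ := (Fintype.card ι : ℝ) with hm
  set M : ℝ := (Fintype.card σ : ℝ) with hMdef
  have hmpos : 0 < m := by rw [hm]; exact_mod_cast Fintype.card_pos
  have hbpos : 0 < b := by linarith
  have hbM : b * m ≤ M := (Nat.le_ceil _).trans (by rw [hMdef]; exact_mod_cast hM)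
  have hMpos : 0 < M := lt_of_lt_of_le (by positivity) hbM
  have hone : ∑ i, vecMulVec (star (V i)) (star (star (V i))) = 1 := by
    rw [← hV]
    ext i j
    simp [Matrix.sum_apply, vecMulVec_apply, Matrix.mul_apply]
  set ε : ℝ := 1 - 1 / b with hε
  have hε0 : 0 < ε := by rw [hε, sub_pos, div_lt_one hbpos]; exact hb
  have hε1 : ε < 1 := by rw [hε]; have : 0 < 1 / b := by positivity
                         linarith
  have hbε : b * (1 - ε) = 1 := by rw [hε]; field_simp; ring
  have hL : m / M * ((b - 1) ^ 3 / (216 * b ^ 3)) = m / M * (ε ^ 3 / 216) := by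
    have : ε = (b - 1) / b := by rw [hε]; field_simp
    rw [this, div_pow]; field_simp
  have hr : m / M ≤ 1 - ε := by
    rw [div_le_iff₀ hMpos]
    nlinarith
  have hr0 : 0 < m / M := by positivity
  rw [hL]
  set L : ℝ := m / M * (ε ^ 3 / 216) with hLdef
  set κ : ℝ := m / M * (ε / 6) with hκdef
  set δ : ℝ := (L + κ) / (b * m) with hδdef
  have hL0 : 0 < L := by positivity
  have hκ0 : 0 < κ := by positivity
  have hδ0 : 0 < δ := by positivity
  have hτ : L + κ ≤ ε / 5 := by
    have h1 : L + κ = m / M * (ε * (ε ^ 2 / 216 + 1 / 6)) := by rw [hLdef, hκdef]; ring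
    have h2 : ε ^ 2 ≤ 1 := by nlinarith
    calc L + κ = m / M * (ε * (ε ^ 2 / 216 + 1 / 6)) := h1
      _ ≤ 1 * (ε * (1 / 216 + 1 / 6)) := by gcongr; linarith
      _ ≤ ε / 5 := by linarith
  have hδeq : δ = ε / 6 * (1 - ε) * (1 + ε ^ 2 / 36) / M := by
    have : b = 1 / (1 - ε) := by rw [eq_div_iff (by linarith)]; exact hbε
    have h1ε : 1 - ε ≠ 0 := by linarith
    rw [hδdef, hLdef, hκdef, this]
    field_simp
    ring
  have hpoly : (1 - ε) * (1 + ε ^ 2 / 36) < 1 := by nlinarith [sq_nonneg ε, pow_pos hε0 3]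
  obtain ⟨J, hJ, hpsd⟩ := exists_subset_frame_lower_bound (fun i => star (V i)) hone hM
    hδ0 hκ0 (L := L) (by linarith) (by
      have h1 : δ * m = κ * ((1 - ε) * (1 + ε ^ 2 / 36)) := by rw [hδeq, hκdef]; ring
      rw [← hm, h1]
      nlinarith) (by
      rw [← hm, ← hMdef]
      have h1 : m / κ = M * (6 / ε) := by rw [hκdef]; field_simp
      have h2 : M * (1 + 6 / ε) ≤ (1 - (L + κ)) / δ := by
        rw [le_div_iff₀ hδ0, hδeq]
        have : M * (1 + 6 / ε) * (ε / 6 * (1 - ε) * (1 + ε ^ 2 / 36) / M)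
            = (1 + ε / 6) * (1 - ε) * (1 + ε ^ 2 / 36) := by
          field_simp
          ring
        rw [this]
        nlinarith [pow_pos hε0 2, pow_pos hε0 3, pow_pos hε0 4]
      have h3 : κ / δ + M = (1 - L) / δ + M - (1 - (L + κ)) / δ := by ring
      have h4 : (1 - L) * (1 / δ - m / κ) = (1 - L) / δ - m / κ + L * (m / κ) := by ring
      have h5 : 0 ≤ L * (m / κ) := by positivity
      rw [h3, h4]
      nlinarith) (by
      have h1 : b * m * δ = L + κ := by rw [hδdef]; field_simp
      have h2 : b * m * δ ≤ ⌈b * m⌉₊ * δ := by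
        gcongr
        exact Nat.le_ceil _
      linarith)
  refine ⟨J, hJ, fun a => ?_⟩
  have h1 := hpsd.dotProduct_mulVec_nonneg (S *ᵥ a)
  have h2 := star_dotProduct_sum_vecMulVec_mulVec J V (S *ᵥ a)
  have h3 := star_dotProduct_sum_vecMulVec_mulVec Finset.univ V (S *ᵥ a)
  rw [hone, one_mulVec] at h3
  rw [Matrix.sub_mulVec, dotProduct_sub, h2, Matrix.smul_mulVec, one_mulVec, dotProduct_smul, h3,
    smul_eq_mul] at h1
  simp only [← mulVec_mulVec]
  have h4 : (0 : ℝ) ≤ ∑ i ∈ J, ‖(V *ᵥ (S *ᵥ a)) i‖ ^ 2 - L * ∑ i, ‖(V *ᵥ (S *ᵥ a)) i‖ ^ 2 := by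
    exact_mod_cast h1
  linarith

end Barrier

section MatrixExponential

open Matrix
open scoped ComplexOrder

theorem exp_mul_two_sub_le {x : ℝ} (hx : 0 ≤ x) : Real.exp x * (2 - x) ≤ 2 + x := by
  have hderiv : ∀ y, HasDerivAt (fun y : ℝ => 2 + y - Real.exp y * (2 - y))
      (1 - (Real.exp y * (2 - y) + Real.exp y * (-1))) y := fun y =>
    ((hasDerivAt_id y).const_add 2).sub
      ((Real.hasDerivAt_exp y).mul ((hasDerivAt_id y).const_sub 2))
  have hmono : MonotoneOn (fun y : ℝ => 2 + y - Real.exp y * (2 - y)) (Set.Ici 0) := by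
    refine monotoneOn_of_deriv_nonneg (convex_Ici 0)
      (fun y _ => (hderiv y).continuousAt.continuousWithinAt)
      (fun y _ => (hderiv y).differentiableAt.differentiableWithinAt) fun y _ => ?_
    rw [(hderiv y).deriv]
    have h1 : Real.exp y * (1 - y) ≤ Real.exp y * Real.exp (-y) :=
      mul_le_mul_of_nonneg_left (by have := Real.add_one_le_exp (-y); linarith) (Real.exp_pos y).le
    rw [← Real.exp_add, add_neg_cancel, Real.exp_zero] at h1
    linarith
  have := hmono (Set.mem_Ici.2 le_rfl) (Set.mem_Ici.2 hx) hx
  simp only [add_zero, Real.exp_zero, sub_zero, one_mul, sub_self] at this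
  linarith

/-- The divided difference of `exp` is bounded by the arithmetic mean of the end values. -/
theorem exp_sub_exp_div_le (x y : ℝ) (hxy : x ≠ y) :
    (Real.exp y - Real.exp x) / (y - x) ≤ (Real.exp y + Real.exp x) / 2 := by
  wlog h : x < y generalizing x y
  · have := this y x hxy.symm (lt_of_le_of_ne (not_lt.1 h) hxy.symm)
    rw [← neg_div_neg_eq, neg_sub, neg_sub, add_comm]
    exact this
  have h1 := exp_mul_two_sub_le (sub_nonneg.2 h.le)
  have h2 : Real.exp y = Real.exp x * Real.exp (y - x) := by
    rw [← Real.exp_add]; ring_nf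
  rw [div_le_iff₀ (sub_pos.2 h), h2]
  nlinarith [Real.exp_pos x, mul_le_mul_of_nonneg_left h1 (Real.exp_pos x).le]

variable {ι : Type*} [Fintype ι]

/-- Growth of the exponential quadratic form under a rank-one perturbation, in eigenvector
coordinates. -/
theorem sum_exp_mul_rank_one_growth {W : Matrix ι ι ℂ} {α β : ι → ℂ} (hαβ : α = W *ᵥ β)
    (hβα : β = Wᴴ *ᵥ α) {l l' : ι → ℝ} {h : ℝ} (hh : 0 ≤ h)
    (hrel : ∀ i j, W i j * ((l' j - l i : ℝ) : ℂ) = h * (α i * star (β j)))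
    (hα : ∑ i, ‖α i‖ ^ 2 ≤ 1) (hβ : ∑ j, ‖β j‖ ^ 2 ≤ 1) :
    ∑ j, Real.exp (l' j) * ‖β j‖ ^ 2 - ∑ i, Real.exp (l i) * ‖α i‖ ^ 2
      ≤ h / 2 * (∑ j, Real.exp (l' j) * ‖β j‖ ^ 2 + ∑ i, Real.exp (l i) * ‖α i‖ ^ 2) := by
  set G₁ := ∑ j, Real.exp (l' j) * ‖β j‖ ^ 2 with hG1
  set G₀ := ∑ i, Real.exp (l i) * ‖α i‖ ^ 2 with hG0
  have hG1n : 0 ≤ G₁ := Finset.sum_nonneg fun _ _ => by positivity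
  have hG0n : 0 ≤ G₀ := Finset.sum_nonneg fun _ _ => by positivity
  have e1 : (G₁ : ℂ) = ∑ i, ∑ j, star (α i) * W i j * β j * Real.exp (l' j) := by
    rw [Finset.sum_comm, hG1, Complex.ofReal_sum]
    refine Finset.sum_congr rfl fun j _ => ?_
    have : star (β j) = ∑ i, star (α i) * W i j := by
      conv_lhs => rw [hβα]
      simp only [mulVec, dotProduct, star_sum, conjTranspose_apply, star_mul', star_star]
      exact Finset.sum_congr rfl fun i _ => mul_comm _ _
    rw [← Finset.sum_mul, ← Finset.sum_mul, ← this]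
    push_cast
    rw [← Complex.conj_mul', RCLike.star_def]
    ring
  have e0 : (G₀ : ℂ) = ∑ i, ∑ j, star (α i) * W i j * β j * Real.exp (l i) := by
    rw [hG0, Complex.ofReal_sum]
    refine Finset.sum_congr rfl fun i _ => ?_
    have : α i = ∑ j, W i j * β j := by
      conv_lhs => rw [hαβ]
      rfl
    simp only [mul_assoc (star (α i))]
    rw [← Finset.mul_sum, ← Finset.sum_mul, ← this]
    push_cast
    rw [← Complex.conj_mul', RCLike.star_def]
    ring
  have e2 : ((G₁ - G₀ : ℝ) : ℂ)
      = ∑ i, ∑ j, star (α i) * W i j * β j * ((Real.exp (l' j) - Real.exp (l i) : ℝ) : ℂ) := by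
    rw [Complex.ofReal_sub, e1, e0, ← Finset.sum_sub_distrib]
    refine Finset.sum_congr rfl fun i _ => ?_
    rw [← Finset.sum_sub_distrib]
    refine Finset.sum_congr rfl fun j _ => ?_
    push_cast
    ring
  have hterm : ∀ i j,
      (star (α i) * W i j * β j * ((Real.exp (l' j) - Real.exp (l i) : ℝ) : ℂ)).re
        ≤ h / 2 * (‖α i‖ ^ 2 * (Real.exp (l' j) * ‖β j‖ ^ 2)
          + Real.exp (l i) * ‖α i‖ ^ 2 * ‖β j‖ ^ 2) := by
    intro i j
    by_cases hl : l i = l' j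
    · rw [hl]
      simp only [sub_self, Complex.ofReal_zero, mul_zero, Complex.zero_re]
      positivity
    · have hne : ((l' j - l i : ℝ) : ℂ) ≠ 0 := by
        rw [Complex.ofReal_ne_zero, sub_ne_zero]
        exact Ne.symm hl
      have hWij : W i j = h * (α i * star (β j)) / ((l' j - l i : ℝ) : ℂ) := by
        rw [eq_div_iff hne, hrel]
      have : star (α i) * W i j * β j * ((Real.exp (l' j) - Real.exp (l i) : ℝ) : ℂ)
          = ((h * (‖α i‖ ^ 2 * ‖β j‖ ^ 2) *
            ((Real.exp (l' j) - Real.exp (l i)) / (l' j - l i)) : ℝ) : ℂ) := by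
        rw [hWij]
        push_cast
        rw [← Complex.conj_mul', ← Complex.conj_mul', RCLike.star_def]
        ring
      rw [this, Complex.ofReal_re]
      calc _ ≤ h * (‖α i‖ ^ 2 * ‖β j‖ ^ 2) * ((Real.exp (l' j) + Real.exp (l i)) / 2) :=
            mul_le_mul_of_nonneg_left (exp_sub_exp_div_le _ _ hl) (by positivity)
        _ = _ := by ring
  have e3 : G₁ - G₀ ≤ ∑ i, ∑ j, h / 2 * (‖α i‖ ^ 2 * (Real.exp (l' j) * ‖β j‖ ^ 2)
          + Real.exp (l i) * ‖α i‖ ^ 2 * ‖β j‖ ^ 2) := by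
    rw [← Complex.ofReal_re (G₁ - G₀), e2, Complex.re_sum]
    refine Finset.sum_le_sum fun i _ => ?_
    rw [Complex.re_sum]
    exact Finset.sum_le_sum fun j _ => hterm i j
  have e4 : ∑ i, ∑ j, h / 2 * (‖α i‖ ^ 2 * (Real.exp (l' j) * ‖β j‖ ^ 2)
          + Real.exp (l i) * ‖α i‖ ^ 2 * ‖β j‖ ^ 2)
      = h / 2 * ((∑ i, ‖α i‖ ^ 2) * G₁ + G₀ * ∑ j, ‖β j‖ ^ 2) := by
    rw [hG1, hG0, Finset.sum_mul_sum, Finset.sum_mul_sum, ← Finset.sum_add_distrib,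
      Finset.mul_sum]
    refine Finset.sum_congr rfl fun i _ => ?_
    rw [← Finset.sum_add_distrib, Finset.mul_sum]
  refine e3.trans (e4.trans_le (mul_le_mul_of_nonneg_left ?_ (by positivity)))
  nlinarith

theorem isHermitian_smul_vecMulVec_star (c : ℝ) (y : ι → ℂ) :
    ((c : ℂ) • vecMulVec y (star y)).IsHermitian := by
  have h := (posSemidef_vecMulVec_self_star y).isHermitian
  rw [IsHermitian, conjTranspose_smul, h.eq]
  simp

variable [DecidableEq ι]

theorem sum_row_norm_sq {W : Matrix ι ι ℂ} (hW : W * Wᴴ = 1) (i : ι) :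
    ∑ j, ‖W i j‖ ^ 2 = 1 := by
  have h : (W * Wᴴ) i i = 1 := by rw [hW]; simp
  rw [Matrix.mul_apply] at h
  simp only [conjTranspose_apply, RCLike.star_def, Complex.mul_conj'] at h
  exact_mod_cast h

theorem sum_column_norm_sq {W : Matrix ι ι ℂ} (hW : Wᴴ * W = 1) (j : ι) :
    ∑ i, ‖W i j‖ ^ 2 = 1 := by
  have h : (Wᴴ * W) j j = 1 := by rw [hW]; simp
  rw [Matrix.mul_apply] at h
  simp only [conjTranspose_apply, RCLike.star_def, Complex.conj_mul'] at h
  exact_mod_cast h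

/-- Klein's inequality for a rank-one perturbation, in eigenvector coordinates. -/
theorem sum_exp_rank_one_lower {W : Matrix ι ι ℂ} (hW : Wᴴ * W = 1) (hW' : W * Wᴴ = 1)
    {α β : ι → ℂ} (hαβ : α = W *ᵥ β) {l l' : ι → ℝ} {h : ℝ}
    (hrel : ∀ i j, W i j * ((l' j - l i : ℝ) : ℂ) = h * (α i * star (β j))) :
    ∑ i, Real.exp (l i) + h * ∑ i, Real.exp (l i) * ‖α i‖ ^ 2 ≤ ∑ j, Real.exp (l' j) := by
  have h0 : ∑ i, Real.exp (l i) = ∑ i, ∑ j, ‖W i j‖ ^ 2 * Real.exp (l i) := by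
    refine Finset.sum_congr rfl fun i _ => ?_
    rw [← Finset.sum_mul, sum_row_norm_sq hW', one_mul]
  have h1 : ∑ j, Real.exp (l' j) = ∑ i, ∑ j, ‖W i j‖ ^ 2 * Real.exp (l' j) := by
    rw [Finset.sum_comm]
    refine Finset.sum_congr rfl fun j _ => ?_
    rw [← Finset.sum_mul, sum_column_norm_sq hW, one_mul]
  have h2 : h * ∑ i, Real.exp (l i) * ‖α i‖ ^ 2
      = ∑ i, ∑ j, ‖W i j‖ ^ 2 * ((l' j - l i) * Real.exp (l i)) := by
    rw [Finset.mul_sum]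
    refine Finset.sum_congr rfl fun i _ => ?_
    have h3 : ((∑ j, ‖W i j‖ ^ 2 * (l' j - l i) : ℝ) : ℂ) = ((h * ‖α i‖ ^ 2 : ℝ) : ℂ) := by
      push_cast
      rw [← Complex.mul_conj']
      calc ∑ j, (‖W i j‖ : ℂ) ^ 2 * ((l' j : ℂ) - l i)
          = ∑ j, star (W i j) * (h * (α i * star (β j))) := by
            refine Finset.sum_congr rfl fun j _ => ?_
            rw [← hrel, ← Complex.conj_mul', RCLike.star_def]
            push_cast
            ring
        _ = h * (α i * star (∑ j, W i j * β j)) := by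
            rw [star_sum, Finset.mul_sum, Finset.mul_sum]
            refine Finset.sum_congr rfl fun j _ => ?_
            rw [star_mul']
            ring
        _ = h * (α i * (starRingEnd ℂ) (α i)) := by
            conv_rhs => rw [hαβ]
            rw [hαβ]
            rfl
    have h4 : ∑ j, ‖W i j‖ ^ 2 * (l' j - l i) = h * ‖α i‖ ^ 2 := by exact_mod_cast h3
    calc h * (Real.exp (l i) * ‖α i‖ ^ 2) = (h * ‖α i‖ ^ 2) * Real.exp (l i) := by ring
      _ = _ := by
        rw [← h4, Finset.sum_mul]
        exact Finset.sum_congr rfl fun j _ => by ring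
  rw [h0, h1, h2, ← Finset.sum_add_distrib]
  refine Finset.sum_le_sum fun i _ => ?_
  rw [← Finset.sum_add_distrib]
  refine Finset.sum_le_sum fun j _ => ?_
  rw [← mul_add]
  refine mul_le_mul_of_nonneg_left ?_ (sq_nonneg _)
  have h5 := Real.add_one_le_exp (l' j - l i)
  have h6 : Real.exp (l' j) = Real.exp (l i) * Real.exp (l' j - l i) := by
    rw [← Real.exp_add]; ring_nf
  rw [h6]
  nlinarith [Real.exp_pos (l i), mul_le_mul_of_nonneg_left h5 (Real.exp_pos (l i)).le]

/-- The trace exponential of a matrix. -/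
noncomputable def traceExp (K : Matrix ι ι ℂ) : ℝ := (NormedSpace.exp K).trace.re

/-- The quadratic form of the exponential of a matrix. -/
noncomputable def expForm (K : Matrix ι ι ℂ) (y : ι → ℂ) : ℝ :=
  (star y ⬝ᵥ NormedSpace.exp K *ᵥ y).re

theorem exp_spectralMatrix {U : Matrix ι ι ℂ} (hU' : U * Uᴴ = 1) (d : ι → ℝ) :
    NormedSpace.exp (spectralMatrix U d) = spectralMatrix U (fun i => Real.exp (d i)) := by
  have hunit : IsUnit U := IsUnit.of_mul_eq_one _ hU'
  have hinv : Uᴴ = U⁻¹ := (Matrix.inv_eq_right_inv hU').symm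
  rw [spectralMatrix, spectralMatrix, hinv, Matrix.exp_conj _ _ hunit, Matrix.exp_diagonal]
  congr 3
  funext i
  rw [Pi.exp_def]
  simp [Complex.exp_eq_exp_ℂ]

theorem traceExp_spectralMatrix {U : Matrix ι ι ℂ} (hU : Uᴴ * U = 1) (hU' : U * Uᴴ = 1)
    (d : ι → ℝ) : traceExp (spectralMatrix U d) = ∑ i, Real.exp (d i) := by
  rw [traceExp, exp_spectralMatrix hU', trace_spectralMatrix hU, Complex.ofReal_re]

theorem expForm_spectralMatrix {U : Matrix ι ι ℂ} (hU' : U * Uᴴ = 1)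
    (d : ι → ℝ) (y : ι → ℂ) :
    expForm (spectralMatrix U d) y = ∑ i, Real.exp (d i) * ‖(Uᴴ *ᵥ y) i‖ ^ 2 := by
  rw [expForm, exp_spectralMatrix hU', star_dotProduct_spectralMatrix_mulVec, Complex.ofReal_re]

theorem sum_norm_sq_conjTranspose_mulVec {U : Matrix ι ι ℂ} (hU' : U * Uᴴ = 1) (y : ι → ℂ) :
    ∑ i, ‖(Uᴴ *ᵥ y) i‖ ^ 2 = ∑ i, ‖y i‖ ^ 2 := by
  have h := star_dotProduct_spectralMatrix_mulVec U (fun _ => 1) y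
  rw [spectralMatrix_const hU', Complex.ofReal_one, one_smul, one_mulVec, dotProduct] at h
  simp only [Pi.star_apply, RCLike.star_def, Complex.conj_mul', one_mul] at h
  exact_mod_cast h.symm

theorem rank_one_exp_inequalities {K : Matrix ι ι ℂ} (hK : K.IsHermitian) {y : ι → ℂ}
    (hy : ∑ i, ‖y i‖ ^ 2 ≤ 1) {h : ℝ} (hh : 0 ≤ h) :
    traceExp K + h * expForm K y ≤ traceExp (K + (h : ℂ) • vecMulVec y (star y)) ∧
    expForm (K + (h : ℂ) • vecMulVec y (star y)) y - expForm K y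
      ≤ h / 2 * (expForm (K + (h : ℂ) • vecMulVec y (star y)) y + expForm K y) := by
  have hK' : (K + (h : ℂ) • vecMulVec y (star y)).IsHermitian :=
    hK.add ((posSemidef_vecMulVec_self_star y).smul (by exact_mod_cast hh)).isHermitian
  obtain ⟨U, d, hU, hU', hKd⟩ := hK.exists_eq_spectralMatrix
  obtain ⟨U₁, d₁, hU₁, hU₁', hKd₁⟩ := hK'.exists_eq_spectralMatrix
  have hW : (Uᴴ * U₁)ᴴ * (Uᴴ * U₁) = 1 := by
    rw [conjTranspose_mul, conjTranspose_conjTranspose, Matrix.mul_assoc, ← Matrix.mul_assoc U,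
      hU', Matrix.one_mul, hU₁]
  have hW' : (Uᴴ * U₁) * (Uᴴ * U₁)ᴴ = 1 := by
    rw [conjTranspose_mul, conjTranspose_conjTranspose, Matrix.mul_assoc, ← Matrix.mul_assoc U₁,
      hU₁', Matrix.one_mul, hU]
  have hαβ : Uᴴ *ᵥ y = (Uᴴ * U₁) *ᵥ (U₁ᴴ *ᵥ y) := by
    rw [mulVec_mulVec, Matrix.mul_assoc, hU₁', Matrix.mul_one]
  have hβα : U₁ᴴ *ᵥ y = (Uᴴ * U₁)ᴴ *ᵥ (Uᴴ *ᵥ y) := by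
    rw [mulVec_mulVec, conjTranspose_mul, conjTranspose_conjTranspose, Matrix.mul_assoc, hU',
      Matrix.mul_one]
  have hmat : (Uᴴ * U₁) * diagonal (fun i => (d₁ i : ℂ)) - diagonal (fun i => (d i : ℂ)) * (Uᴴ * U₁)
      = (h : ℂ) • vecMulVec (Uᴴ *ᵥ y) (star (U₁ᴴ *ᵥ y)) := by
    have e1 : (Uᴴ * U₁) * diagonal (fun i => (d₁ i : ℂ))
        = Uᴴ * (K + (h : ℂ) • vecMulVec y (star y)) * U₁ := by
      rw [hKd₁, spectralMatrix]
      simp only [Matrix.mul_assoc]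
      rw [hU₁, Matrix.mul_one]
    have e2 : diagonal (fun i => (d i : ℂ)) * (Uᴴ * U₁) = Uᴴ * K * U₁ := by
      rw [hKd, spectralMatrix]
      simp only [← Matrix.mul_assoc]
      rw [hU, Matrix.one_mul]
    rw [e1, e2, Matrix.mul_add, Matrix.add_mul, add_sub_cancel_left, Matrix.mul_smul,
      Matrix.smul_mul, mul_vecMulVec, vecMulVec_mul, star_mulVec, conjTranspose_conjTranspose]
  have hrel : ∀ i j, (Uᴴ * U₁) i j * ((d₁ j - d i : ℝ) : ℂ)
      = h * ((Uᴴ *ᵥ y) i * star ((U₁ᴴ *ᵥ y) j)) := fun i j => by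
    have := congrFun (congrFun hmat i) j
    rw [Matrix.sub_apply, mul_diagonal, diagonal_mul, Matrix.smul_apply, vecMulVec_apply,
      smul_eq_mul, Pi.star_apply] at this
    rw [← this]
    push_cast
    ring
  rw [hKd₁, hKd, traceExp_spectralMatrix hU hU', traceExp_spectralMatrix hU₁ hU₁',
    expForm_spectralMatrix hU', expForm_spectralMatrix hU₁']
  refine ⟨sum_exp_rank_one_lower hW hW' hαβ hrel, sum_exp_mul_rank_one_growth hαβ hβα hh hrel ?_ ?_⟩
  · rwa [sum_norm_sq_conjTranspose_mulVec hU']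
  · rwa [sum_norm_sq_conjTranspose_mulVec hU₁']

theorem expForm_nonneg {K : Matrix ι ι ℂ} (hK : K.IsHermitian) (y : ι → ℂ) : 0 ≤ expForm K y := by
  obtain ⟨U, d, -, hU', rfl⟩ := hK.exists_eq_spectralMatrix
  rw [expForm_spectralMatrix hU']
  positivity

theorem traceExp_nonneg {K : Matrix ι ι ℂ} (hK : K.IsHermitian) : 0 ≤ traceExp K := by
  obtain ⟨U, d, hU, hU', rfl⟩ := hK.exists_eq_spectralMatrix
  rw [traceExp_spectralMatrix hU hU']
  positivity

theorem traceExp_sub_rank_one_le_of_steps {H : Matrix ι ι ℂ} (hH : H.IsHermitian) {y : ι → ℂ}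
    (hy : ∑ i, ‖y i‖ ^ 2 ≤ 1) {h : ℝ} (hh : 0 ≤ h) (hh2 : h < 2) (n : ℕ) :
    traceExp (H - ((n * h : ℝ) : ℂ) • vecMulVec y (star y))
      ≤ traceExp H - (1 - h / 2) * (1 - ((1 - h / 2) / (1 + h / 2)) ^ n) * expForm H y ∧
    ((1 - h / 2) / (1 + h / 2)) ^ n * expForm H y
      ≤ expForm (H - ((n * h : ℝ) : ℂ) • vecMulVec y (star y)) y := by
  set ρ := (1 - h / 2) / (1 + h / 2) with hρ
  have hden : 0 < 1 + h / 2 := by linarith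
  have hρ0 : 0 ≤ ρ := div_nonneg (by linarith) hden.le
  induction n with
  | zero => simp
  | succ n ih =>
    obtain ⟨ih1, ih2⟩ := ih
    have hK : (H - (((n + 1 : ℕ) * h : ℝ) : ℂ) • vecMulVec y (star y)).IsHermitian :=
      hH.sub (isHermitian_smul_vecMulVec_star _ y)
    obtain ⟨h1, h2⟩ := rank_one_exp_inequalities hK hy hh
    have hstep : H - (((n + 1 : ℕ) * h : ℝ) : ℂ) • vecMulVec y (star y)
        + (h : ℂ) • vecMulVec y (star y) = H - ((n * h : ℝ) : ℂ) • vecMulVec y (star y) := by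
      push_cast
      rw [add_mul, add_smul, one_mul]
      abel
    rw [hstep] at h1 h2
    set E' := expForm (H - (((n + 1 : ℕ) * h : ℝ) : ℂ) • vecMulVec y (star y)) y
    set E := expForm (H - ((n * h : ℝ) : ℂ) • vecMulVec y (star y)) y
    have hE : ρ * E ≤ E' := by
      rw [hρ, div_mul_eq_mul_div, div_le_iff₀ hden]
      linarith
    have hnew : ρ ^ (n + 1) * expForm H y ≤ E' := by
      calc ρ ^ (n + 1) * expForm H y = ρ * (ρ ^ n * expForm H y) := by ring
        _ ≤ ρ * E := mul_le_mul_of_nonneg_left ih2 hρ0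
        _ ≤ E' := hE
    refine ⟨?_, hnew⟩
    have hid : h * ρ = (1 - h / 2) * (1 - ρ) := by
      rw [hρ]; field_simp; ring
    have h3 := mul_le_mul_of_nonneg_left hnew hh
    have h4 : h * (ρ ^ (n + 1) * expForm H y)
        = (1 - h / 2) * (1 - ρ ^ (n + 1)) * expForm H y
          - (1 - h / 2) * (1 - ρ ^ n) * expForm H y := by
      calc h * (ρ ^ (n + 1) * expForm H y) = (h * ρ) * (ρ ^ n * expForm H y) := by ring
        _ = _ := by rw [hid]; ring
    linarith

/-- The trace exponential after subtracting a rank-one matrix of norm at most one. -/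
theorem traceExp_sub_rank_one_le {H : Matrix ι ι ℂ} (hH : H.IsHermitian) {y : ι → ℂ}
    (hy : ∑ i, ‖y i‖ ^ 2 ≤ 1) {θ : ℝ} (hθ : 0 ≤ θ) (hθ2 : θ < 2) :
    traceExp (H - (θ : ℂ) • vecMulVec y (star y))
      ≤ traceExp H - (1 - Real.exp (-θ)) * expForm H y := by
  have hn : ∀ n : ℕ, traceExp (H - (θ : ℂ) • vecMulVec y (star y))
      ≤ traceExp H - (1 - θ * (1 / ((n : ℝ) + 1)) / 2) * (1 - Real.exp (-θ)) * expForm H y := by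
    intro n
    have hn1 : (0 : ℝ) < n + 1 := by positivity
    set h := θ * (1 / ((n : ℝ) + 1)) with hh
    have hh0 : 0 ≤ h := by positivity
    have hhθ : h ≤ θ := by
      rw [hh]
      refine mul_le_of_le_one_right hθ ?_
      rw [div_le_one hn1]
      linarith [(Nat.cast_nonneg n : (0 : ℝ) ≤ n)]
    have hmul : ((n + 1 : ℕ) : ℝ) * h = θ := by
      rw [hh]; push_cast; field_simp
    obtain ⟨h1, -⟩ := traceExp_sub_rank_one_le_of_steps hH hy hh0 (by linarith) (n + 1)
    rw [hmul] at h1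
    refine h1.trans (sub_le_sub_left (mul_le_mul_of_nonneg_right
      (mul_le_mul_of_nonneg_left (sub_le_sub_left ?_ 1) (by linarith)) (expForm_nonneg hH y)) _)
    have hρ : (1 - h / 2) / (1 + h / 2) ≤ Real.exp (-h) := by
      rw [Real.exp_neg, div_le_iff₀ (by linarith), inv_mul_eq_div, le_div_iff₀ (Real.exp_pos h)]
      linarith [exp_mul_two_sub_le hh0]
    calc ((1 - h / 2) / (1 + h / 2)) ^ (n + 1) ≤ Real.exp (-h) ^ (n + 1) :=
          pow_le_pow_left₀ (div_nonneg (by linarith) (by linarith)) hρ _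
      _ = Real.exp (-θ) := by
          rw [← Real.exp_nat_mul, mul_neg, hmul]
  refine ge_of_tendsto' (x := Filter.atTop) ?_ hn
  have hlim : Filter.Tendsto (fun n : ℕ => traceExp H -
      (1 - θ * (1 / ((n : ℝ) + 1)) / 2) * (1 - Real.exp (-θ)) * expForm H y) Filter.atTop
      (nhds (traceExp H - (1 - θ * 0 / 2) * (1 - Real.exp (-θ)) * expForm H y)) :=
    Filter.Tendsto.const_sub _ (((((tendsto_one_div_add_atTop_nhds_zero_nat.const_mul
      θ).div_const 2).const_sub 1).mul_const _).mul_const _)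
  simpa using hlim

theorem traceExp_lower {S : Matrix ι ι ℂ} (hS : S.IsHermitian) {θ c : ℝ} (hθ : 0 ≤ θ)
    (hlt : ¬ (S - (c : ℂ) • (1 : Matrix ι ι ℂ)).PosDef) :
    Real.exp (-(θ * c)) ≤ traceExp (-((θ : ℂ) • S)) := by
  obtain ⟨U, d, hU, hU', rfl⟩ := hS.exists_eq_spectralMatrix
  rw [← spectralMatrix_const hU', spectralMatrix_sub, posDef_spectralMatrix_iff hU'] at hlt
  push Not at hlt
  obtain ⟨i, hi⟩ := hlt
  have : -((θ : ℂ) • spectralMatrix U d) = spectralMatrix U (fun i => -(θ * d i)) := by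
    rw [← Matrix.one_mul (spectralMatrix U d), ← Matrix.smul_mul, ← spectralMatrix_const hU',
      spectralMatrix_mul hU, ← zero_sub, ← zero_smul ℂ (1 : Matrix ι ι ℂ), ← Complex.ofReal_zero,
      ← spectralMatrix_const hU', spectralMatrix_sub]
    simp only [zero_sub]
  rw [this, traceExp_spectralMatrix hU hU']
  calc Real.exp (-(θ * c)) ≤ Real.exp (-(θ * d i)) := by
        apply Real.exp_le_exp.2
        nlinarith
    _ ≤ _ := Finset.single_le_sum (f := fun i => Real.exp (-(θ * d i)))
        (fun _ _ => (Real.exp_pos _).le) (Finset.mem_univ i)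

theorem continuous_traceExp : Continuous (traceExp : Matrix ι ι ℂ → ℝ) := by
  let _ : NormedRing (Matrix ι ι ℂ) := Matrix.linftyOpNormedRing
  let _ : NormedAlgebra ℂ (Matrix ι ι ℂ) := Matrix.linftyOpNormedAlgebra
  let _ : NormedAlgebra ℚ (Matrix ι ι ℂ) := NormedAlgebra.restrictScalars ℚ ℂ _
  have h : Continuous (NormedSpace.exp : Matrix ι ι ℂ → Matrix ι ι ℂ) :=
    NormedSpace.exp_continuous
  exact Complex.continuous_re.comp h.matrix_trace

end MatrixExponential

section MatrixChernoff

open Matrix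

variable {ι : Type*} [Fintype ι]

theorem norm_le_one_of_sum_sq_le {v : ι → ℂ} (hv : ∑ i, ‖v i‖ ^ 2 ≤ 1) (i : ι) : ‖v i‖ ≤ 1 := by
  have h := (Finset.single_le_sum (f := fun i => ‖v i‖ ^ 2) (fun _ _ => sq_nonneg _)
    (Finset.mem_univ i)).trans hv
  exact (sq_le_one_iff₀ (norm_nonneg _)).1 h

variable [DecidableEq ι] {D : Type*} [MeasurableSpace D]

theorem measurable_traceExp_comp {F : D → Matrix ι ι ℂ}
    (hF : ∀ i j, Measurable fun x => F x i j) : Measurable fun x => traceExp (F x) := by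
  have h : Continuous (fun A : ι → ι → ℂ => traceExp (Matrix.of A)) :=
    continuous_traceExp.comp continuous_id
  exact h.measurable.comp (measurable_pi_lambda _ fun i => measurable_pi_lambda _ fun j => hF i j)

variable {μ : Measure D} [IsProbabilityMeasure μ] {y : D → ι → ℂ} {R θ : ℝ}

theorem integral_expForm (hmeas : ∀ i, Measurable fun x => y x i)
    (hy : ∀ x, ∑ i, ‖y x i‖ ^ 2 ≤ 1)
    (hiso : ∀ i j, ∫ x, y x i * (starRingEnd ℂ) (y x j) ∂μ = if i = j then (R : ℂ)⁻¹ else 0)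
    (H : Matrix ι ι ℂ) :
    Integrable (fun x => expForm H (y x)) μ ∧ ∫ x, expForm H (y x) ∂μ = traceExp H * R⁻¹ := by
  have hint : ∀ i j, Integrable (fun x => y x i * (starRingEnd ℂ) (y x j)) μ := fun i j => by
    refine Integrable.of_bound ((hmeas i).mul
      (Complex.continuous_conj.measurable.comp (hmeas j))).aestronglyMeasurable 1
      (Filter.Eventually.of_forall fun x => ?_)
    rw [norm_mul, RCLike.norm_conj]
    exact mul_le_one₀ (norm_le_one_of_sum_sq_le (hy x) i) (norm_nonneg _)
      (norm_le_one_of_sum_sq_le (hy x) j)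
  obtain ⟨E, hE⟩ : ∃ E : ι → ι → ℂ, E = NormedSpace.exp H := ⟨_, rfl⟩
  have hform : ∀ v, expForm H v = (∑ i, ∑ j, E i j * (v j * (starRingEnd ℂ) (v i))).re := by
    intro v
    rw [expForm, ← hE]
    simp only [dotProduct, mulVec, Finset.mul_sum, Pi.star_apply, RCLike.star_def]
    congr 1
    exact Finset.sum_congr rfl fun i _ => Finset.sum_congr rfl fun j _ => by ring
  have hrow : ∀ i, Integrable (fun x => ∑ j, E i j * (y x j * (starRingEnd ℂ) (y x i))) μ :=
    fun i => integrable_finsetSum _ fun j _ => (hint j i).const_mul _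
  have hsum : Integrable (fun x => ∑ i, ∑ j, E i j * (y x j * (starRingEnd ℂ) (y x i))) μ :=
    integrable_finsetSum _ fun i _ => hrow i
  simp only [hform]
  refine ⟨hsum.re, (integral_re hsum).trans ?_⟩
  rw [integral_finsetSum _ fun i _ => hrow i]
  have hrow' : ∀ i, ∫ x, ∑ j, E i j * (y x j * (starRingEnd ℂ) (y x i)) ∂μ
      = E i i * (R : ℂ)⁻¹ := fun i => by
    rw [integral_finsetSum _ fun j _ => (hint j i).const_mul _]
    simp only [integral_const_mul, hiso]
    simp
  simp only [hrow', ← Finset.sum_mul]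
  rw [traceExp, ← hE, ← Complex.ofReal_inv, RCLike.re_to_complex, Complex.re_mul_ofReal]
  rfl

theorem lintegral_traceExp_sub_rank_one_le (hmeas : ∀ i, Measurable fun x => y x i)
    (hy : ∀ x, ∑ i, ‖y x i‖ ^ 2 ≤ 1)
    (hiso : ∀ i j, ∫ x, y x i * (starRingEnd ℂ) (y x j) ∂μ = if i = j then (R : ℂ)⁻¹ else 0)
    (hθ : 0 ≤ θ) (hθ2 : θ < 2) {H : Matrix ι ι ℂ} (hH : H.IsHermitian) :
    ∫⁻ x, ENNReal.ofReal (traceExp (H - (θ : ℂ) • vecMulVec (y x) (star (y x)))) ∂μ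
      ≤ ENNReal.ofReal (1 - (1 - Real.exp (-θ)) * R⁻¹) * ENNReal.ofReal (traceExp H) := by
  obtain ⟨hint, heq⟩ := integral_expForm hmeas hy hiso H
  have hle := fun x => traceExp_sub_rank_one_le hH (hy x) hθ hθ2
  calc _ ≤ ∫⁻ x, ENNReal.ofReal (traceExp H - (1 - Real.exp (-θ)) * expForm H (y x)) ∂μ :=
        lintegral_mono fun x => ENNReal.ofReal_le_ofReal (hle x)
    _ = ENNReal.ofReal (∫ x, (traceExp H - (1 - Real.exp (-θ)) * expForm H (y x)) ∂μ) := by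
        refine (ofReal_integral_eq_lintegral_ofReal
          ((integrable_const _).sub (hint.const_mul _)) ?_).symm
        refine Filter.Eventually.of_forall fun x => ?_
        exact (traceExp_nonneg (hH.sub (isHermitian_smul_vecMulVec_star θ (y x)))).trans (hle x)
    _ = _ := by
        rw [integral_sub (integrable_const _) (hint.const_mul _), integral_const,
          integral_const_mul, heq, ← ENNReal.ofReal_mul' (traceExp_nonneg hH)]
        congr 1
        simp
        ring

theorem lintegral_pi_traceExp_le (hmeas : ∀ i, Measurable fun x => y x i)
    (hy : ∀ x, ∑ i, ‖y x i‖ ^ 2 ≤ 1)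
    (hiso : ∀ i j, ∫ x, y x i * (starRingEnd ℂ) (y x j) ∂μ = if i = j then (R : ℂ)⁻¹ else 0)
    (hθ : 0 ≤ θ) (hθ2 : θ < 2) (M : ℕ) {H : Matrix ι ι ℂ} (hH : H.IsHermitian) :
    ∫⁻ xs, ENNReal.ofReal (traceExp (H - (θ : ℂ) • ∑ i, vecMulVec (y (xs i)) (star (y (xs i)))))
        ∂Measure.pi (fun _ : Fin M => μ)
      ≤ ENNReal.ofReal (1 - (1 - Real.exp (-θ)) * R⁻¹) ^ M * ENNReal.ofReal (traceExp H) := by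
  induction M generalizing H with
  | zero => simp
  | succ M ih =>
    have hmp := measurePreserving_piFinSuccAbove (fun _ : Fin (M + 1) => μ) 0
    let G : D × (Fin M → D) → ENNReal := fun q => ENNReal.ofReal (traceExp
      (H - (θ : ℂ) • vecMulVec (y q.1) (star (y q.1))
        - (θ : ℂ) • ∑ i, vecMulVec (y (q.2 i)) (star (y (q.2 i)))))
    have hG : ∀ xs : Fin (M + 1) → D,
        ENNReal.ofReal (traceExp (H - (θ : ℂ) • ∑ i, vecMulVec (y (xs i)) (star (y (xs i)))))
          = G (MeasurableEquiv.piFinSuccAbove (fun _ => D) 0 xs) := fun xs => by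
      have hxs : MeasurableEquiv.piFinSuccAbove (fun _ => D) 0 xs
          = (xs 0, fun i : Fin M => xs i.succ) := rfl
      rw [hxs, Fin.sum_univ_succ, smul_add, ← sub_sub]
    have hinner : ∀ x, ∫⁻ ys, G (x, ys) ∂Measure.pi (fun _ : Fin M => μ)
        ≤ ENNReal.ofReal (1 - (1 - Real.exp (-θ)) * R⁻¹) ^ M * ENNReal.ofReal
            (traceExp (H - (θ : ℂ) • vecMulVec (y x) (star (y x)))) := fun x => by
      have hx := hH.sub (isHermitian_smul_vecMulVec_star θ (y x))
      simp only [G]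
      exact ih hx
    simp only [hG]
    rw [hmp.lintegral_comp_emb (MeasurableEquiv.measurableEmbedding _)]
    calc _ ≤ ∫⁻ x, ∫⁻ ys, G (x, ys) ∂Measure.pi (fun _ : Fin M => μ) ∂μ := lintegral_prod_le _
      _ ≤ ∫⁻ x, ENNReal.ofReal (1 - (1 - Real.exp (-θ)) * R⁻¹) ^ M * ENNReal.ofReal
            (traceExp (H - (θ : ℂ) • vecMulVec (y x) (star (y x)))) ∂μ :=
          lintegral_mono hinner
      _ ≤ _ := by
          rw [lintegral_const_mul' _ _ (by finiteness), pow_succ, mul_assoc]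
          gcongr
          exact lintegral_traceExp_sub_rank_one_le hmeas hy hiso hθ hθ2 hH

theorem exp_neg_lt_quadratic {t : ℝ} (ht : 0 < t) : Real.exp (-t) < 1 - t + t ^ 2 / 2 := by
  have h := Real.quadratic_le_exp_of_nonneg ht.le
  rw [Real.exp_neg, inv_lt_comm₀ (Real.exp_pos t) (by nlinarith [sq_nonneg (1 - t)])]
  refine lt_of_lt_of_le ?_ h
  rw [inv_lt_iff_one_lt_mul₀ (by nlinarith [sq_nonneg (1 - t)])]
  nlinarith [pow_pos ht 4]

theorem chernoff_tail_lt {m M : ℕ} (hm : 0 < m) (hM0 : 0 < M) {p t : ℝ} (hp : 0 < p) (ht : 0 < t)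
    (hM : 4 / t ^ 2 * m * Real.log (m / p) ≤ (M : ℝ)) :
    Real.exp (t * ((1 - t) * M / (2 * m))) *
      ((1 - (1 - Real.exp (-t)) * (2 * m : ℝ)⁻¹) ^ M * m) < p := by
  have hm' : (1 : ℝ) ≤ m := by exact_mod_cast hm
  have hMpos : (0 : ℝ) < M := by exact_mod_cast hM0
  set κ := 1 - Real.exp (-t) with hκ
  have hκ1 : κ ≤ 1 := by rw [hκ]; linarith [Real.exp_pos (-t)]
  have hκ2 : t - t ^ 2 / 2 < κ := by rw [hκ]; linarith [exp_neg_lt_quadratic ht]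
  have hinv : (2 * m : ℝ)⁻¹ ≤ 1 := inv_le_one_of_one_le₀ (by linarith)
  have hinv0 : 0 < (2 * m : ℝ)⁻¹ := by positivity
  have hbase : 0 ≤ 1 - κ * (2 * m : ℝ)⁻¹ := by nlinarith
  have hpow : (1 - κ * (2 * m : ℝ)⁻¹) ^ M ≤ Real.exp (-(M * (κ * (2 * m : ℝ)⁻¹))) := by
    rw [← mul_neg, Real.exp_nat_mul]
    refine pow_le_pow_left₀ hbase ?_ _
    linarith [Real.add_one_le_exp (-(κ * (2 * m : ℝ)⁻¹))]
  have hexp : t * ((1 - t) * M / (2 * m)) + -(M * (κ * (2 * m : ℝ)⁻¹)) < -Real.log (m / p) := by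
    have h1 : t * ((1 - t) * M / (2 * m)) + -(M * (κ * (2 * m : ℝ)⁻¹))
        = -(M * (2 * m : ℝ)⁻¹ * (κ - t * (1 - t))) := by
      rw [div_eq_mul_inv]; ring
    have h2 : M * (2 * m : ℝ)⁻¹ * (t ^ 2 / 2) < M * (2 * m : ℝ)⁻¹ * (κ - t * (1 - t)) :=
      mul_lt_mul_of_pos_left (by linarith) (by positivity)
    have h3 : Real.log (m / p) ≤ M * (2 * m : ℝ)⁻¹ * (t ^ 2 / 2) := by
      have h4 : M * (2 * m : ℝ)⁻¹ * (t ^ 2 / 2) = M / (4 / t ^ 2 * m) := by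
        field_simp; norm_num
      rw [h4, le_div_iff₀ (by positivity)]
      linarith
    linarith
  calc _ ≤ Real.exp (t * ((1 - t) * M / (2 * m))) *
        (Real.exp (-(M * (κ * (2 * m : ℝ)⁻¹))) * m) := by gcongr
    _ = m * Real.exp (t * ((1 - t) * M / (2 * m)) + -(M * (κ * (2 * m : ℝ)⁻¹))) := by
        rw [Real.exp_add]; ring
    _ < m * Real.exp (-Real.log (m / p)) := by gcongr
    _ = p := by
        rw [Real.exp_neg, Real.exp_log (by positivity)]
        field_simp

open scoped ComplexOrder in
theorem lt_measure_pi_posDef [Nonempty ι] (hmeas : ∀ i, Measurable fun x => y x i)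
    (hy : ∀ x, ∑ i, ‖y x i‖ ^ 2 ≤ 1)
    (hiso : ∀ i j, ∫ x, y x i * (starRingEnd ℂ) (y x j) ∂μ =
      if i = j then ((2 * Fintype.card ι : ℝ) : ℂ)⁻¹ else 0)
    {p t : ℝ} (hp : 0 < p) (hp1 : p < 1) (ht : 0 < t) (ht1 : t < 1) {M : ℕ} (hM0 : 0 < M)
    (hM : 4 / t ^ 2 * Fintype.card ι * Real.log (Fintype.card ι / p) ≤ (M : ℝ)) :
    ENNReal.ofReal (1 - p) < Measure.pi (fun _ : Fin M => μ)
      {xs | (∑ i, vecMulVec (y (xs i)) (star (y (xs i)))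
        - (((1 - t) * M / (2 * Fintype.card ι) : ℝ) : ℂ) • (1 : Matrix ι ι ℂ)).PosDef} := by
  set m := Fintype.card ι with hm
  set c := (1 - t) * M / (2 * m) with hc
  set P := Measure.pi (fun _ : Fin M => μ) with hP
  let F : (Fin M → D) → ℝ := fun xs =>
    traceExp (0 - (t : ℂ) • ∑ i, vecMulVec (y (xs i)) (star (y (xs i))))
  have hF : Measurable F := by
    refine measurable_traceExp_comp fun i j => ?_
    simp only [Matrix.sub_apply, Matrix.zero_apply, Matrix.smul_apply, Matrix.sum_apply,
      vecMulVec_apply, Pi.star_apply, RCLike.star_def, smul_eq_mul]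
    refine measurable_const.sub (measurable_const.mul (Finset.measurable_sum _ fun k _ => ?_))
    exact ((hmeas i).comp (measurable_pi_apply k)).mul
      (Complex.continuous_conj.measurable.comp ((hmeas j).comp (measurable_pi_apply k)))
  have hgood : {xs | F xs < Real.exp (-(t * c))} ⊆
      {xs | (∑ i, vecMulVec (y (xs i)) (star (y (xs i)))
        - (c : ℂ) • (1 : Matrix ι ι ℂ)).PosDef} := by
    intro xs hxs
    by_contra hnot
    have hherm : (∑ i, vecMulVec (y (xs i)) (star (y (xs i)))).IsHermitian :=
      (posSemidef_sum _ fun i _ => posSemidef_vecMulVec_self_star (y (xs i))).isHermitian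
    have h := traceExp_lower hherm ht.le hnot
    rw [← zero_sub ((t : ℂ) • _)] at h
    exact absurd hxs (not_lt.2 h)
  refine lt_of_lt_of_le ?_ (measure_mono hgood)
  have hbad : P {xs | F xs < Real.exp (-(t * c))}ᶜ < ENNReal.ofReal p := by
    have hcompl : {xs | F xs < Real.exp (-(t * c))}ᶜ
        ⊆ {xs | ENNReal.ofReal (Real.exp (-(t * c))) ≤ ENNReal.ofReal (F xs)} :=
      fun xs hxs => ENNReal.ofReal_le_ofReal (not_lt.1 hxs)
    have hzero : traceExp (0 : Matrix ι ι ℂ) = m := by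
      rw [traceExp, NormedSpace.exp_zero, trace_one]; simp [hm]
    have hpos : 0 ≤ 1 - (1 - Real.exp (-t)) * (2 * m : ℝ)⁻¹ := by
      have h1 : (2 * m : ℝ)⁻¹ ≤ 1 := inv_le_one_of_one_le₀ (by
        have : (1 : ℝ) ≤ m := by exact_mod_cast Fintype.card_pos
        linarith)
      have h2 : 0 ≤ (2 * m : ℝ)⁻¹ := by positivity
      nlinarith [Real.exp_pos (-t)]
    calc _ ≤ _ := measure_mono hcompl
      _ ≤ (∫⁻ xs, ENNReal.ofReal (F xs) ∂P) / ENNReal.ofReal (Real.exp (-(t * c))) :=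
          meas_ge_le_lintegral_div hF.ennreal_ofReal.aemeasurable
            (by simpa using Real.exp_pos _) ENNReal.ofReal_ne_top
      _ ≤ (ENNReal.ofReal (1 - (1 - Real.exp (-t)) * (2 * m : ℝ)⁻¹) ^ M * ENNReal.ofReal m)
            / ENNReal.ofReal (Real.exp (-(t * c))) := by
          have h := lintegral_pi_traceExp_le hmeas hy hiso ht.le (by linarith) M
            (isHermitian_zero (n := ι) (α := ℂ))
          rw [hzero] at h
          exact ENNReal.div_le_div_right h _
      _ = ENNReal.ofReal (Real.exp (t * c) *
            ((1 - (1 - Real.exp (-t)) * (2 * m : ℝ)⁻¹) ^ M * m)) := by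
          rw [← ENNReal.ofReal_pow hpos, ← ENNReal.ofReal_mul (by positivity),
            ← ENNReal.ofReal_div_of_pos (Real.exp_pos _), Real.exp_neg (t * c), div_inv_eq_mul, mul_comm]
      _ < ENNReal.ofReal p :=
          (ENNReal.ofReal_lt_ofReal_iff hp).2 (chernoff_tail_lt Fintype.card_pos hM0 hp ht hM)
  by_contra hnot
  have hset : MeasurableSet {xs | F xs < Real.exp (-(t * c))} := hF measurableSet_Iio
  have hone := prob_add_prob_compl (μ := P) hset
  have hlt := ENNReal.add_lt_add_of_le_of_lt (measure_ne_top P _) (not_lt.1 hnot) hbad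
  rw [hone, ← ENNReal.ofReal_add (by linarith) hp.le] at hlt
  simp at hlt

end MatrixChernoff

section Sampling

open Matrix

variable {D : Type*} {m : ℕ} {η : Fin m → D → ℂ} {φ : D → ℝ}

theorem exists_strictMono_sum_sq_lower_bound (hm : 0 < m) {M : ℕ} (Y : Matrix (Fin M) (Fin m) ℂ)
    {b t : ℝ} (hb : 1 < b) (ht1 : t < 1) (hM : ⌈b * m⌉₊ ≤ M)
    (hlow : ∀ a, ∑ k, ‖a k‖ ^ 2 ≤ 2 / (M * (1 - t)) * ∑ i, ‖(Y *ᵥ a) i‖ ^ 2) :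
    ∃ (n : ℕ) (s : Fin n → Fin M), n ≤ ⌈b * m⌉₊ ∧ StrictMono s ∧ ∀ a : Fin m → ℂ,
      2 / (M * (1 - t)) * ∑ i, ‖(Y *ᵥ a) i‖ ^ 2 ≤
        432 * b ^ 3 / ((b - 1) ^ 3 * (1 - t)) * ((1 / m) * ∑ i, ‖(Y *ᵥ a) (s i)‖ ^ 2) := by
  have hne : Nonempty (Fin m) := ⟨⟨0, hm⟩⟩
  have hmpos : (0 : ℝ) < m := by exact_mod_cast hm
  have hMpos : (0 : ℝ) < M := by
    have : 0 < ⌈b * m⌉₊ := Nat.ceil_pos.2 (by positivity)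
    exact_mod_cast this.trans_le hM
  have hY : Function.Injective Y.mulVec := by
    refine (injective_iff_map_eq_zero Y.mulVecLin).2 fun a ha => ?_
    have h := hlow a
    rw [show Y *ᵥ a = 0 from ha] at h
    simp only [Pi.zero_apply, norm_zero, ne_eq, OfNat.ofNat_ne_zero, not_false_eq_true, zero_pow,
      Finset.sum_const_zero, mul_zero] at h
    have h0 := (Finset.sum_eq_zero_iff_of_nonneg fun k _ => sq_nonneg ‖a k‖).1
      (le_antisymm h (Finset.sum_nonneg fun _ _ => sq_nonneg _))
    funext k
    simpa using h0 k (Finset.mem_univ k)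
  obtain ⟨J, hJ, hbound⟩ := exists_subset_sum_sq_lower_bound Y hY hb (by simpa using hM)
  simp only [Fintype.card_fin] at hJ hbound
  refine ⟨J.card, J.orderEmbOfFin rfl, hJ, (J.orderEmbOfFin rfl).strictMono, fun a => ?_⟩
  have hsum : ∑ i, ‖(Y *ᵥ a) (J.orderEmbOfFin rfl i)‖ ^ 2 = ∑ i ∈ J, ‖(Y *ᵥ a) i‖ ^ 2 := by
    rw [← Finset.sum_coe_sort J]
    exact (J.orderIsoOfFin rfl).toEquiv.sum_comp fun i : J => ‖(Y *ᵥ a) i‖ ^ 2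
  rw [hsum]
  have hb1 : 0 < b - 1 := by linarith
  have ht' : 0 < 1 - t := by linarith
  calc 2 / (M * (1 - t)) * ∑ i, ‖(Y *ᵥ a) i‖ ^ 2
      = 432 * b ^ 3 / ((b - 1) ^ 3 * (1 - t)) * ((1 / m) *
          ((m / M : ℝ) * ((b - 1) ^ 3 / (216 * b ^ 3)) * ∑ i, ‖(Y *ᵥ a) i‖ ^ 2)) := by
        field_simp
        ring
    _ ≤ _ := by
        gcongr
        exact hbound a

theorem half_le_density (hφ : ∀ x, φ x = 1 / 2 + 1 / (2 * m) * ∑ k, ‖η k x‖ ^ 2) (x : D) :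
    1 / 2 ≤ φ x := by
  rw [hφ x]
  have : 0 ≤ 1 / (2 * m : ℝ) * ∑ k, ‖η k x‖ ^ 2 := by positivity
  linarith

/-- The conjugated basis values, normalized by the sampling density. -/
noncomputable def normalizedSample (η : Fin m → D → ℂ) (φ : D → ℝ) (x : D) : Fin m → ℂ :=
  fun k => (starRingEnd ℂ) (η k x) * ((√(2 * m * φ x))⁻¹ : ℝ)

theorem sum_norm_sq_normalizedSample_le (hm : 0 < m)
    (hφ : ∀ x, φ x = 1 / 2 + 1 / (2 * m) * ∑ k, ‖η k x‖ ^ 2) (x : D) :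
    ∑ k, ‖normalizedSample η φ x k‖ ^ 2 ≤ 1 := by
  have hmpos : (0 : ℝ) < m := by exact_mod_cast hm
  have hφ0 := half_le_density hφ x
  have hpos : 0 < 2 * m * φ x := by positivity
  simp only [normalizedSample, norm_mul, RCLike.norm_conj, mul_pow, Complex.norm_real,
    Real.norm_eq_abs, sq_abs, inv_pow, Real.sq_sqrt hpos.le, ← Finset.sum_mul]
  rw [← div_eq_mul_inv, div_le_one hpos, hφ x]
  field_simp
  linarith

open scoped ComplexOrder in
theorem sum_sq_le_of_posDef (hm : 0 < m) {t : ℝ} (ht1 : t < 1)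
    (hφ : ∀ x, φ x = 1 / 2 + 1 / (2 * m) * ∑ k, ‖η k x‖ ^ 2) {M : ℕ} (hM0 : 0 < M)
    {xs : Fin M → D}
    (hxs : (∑ i, vecMulVec (normalizedSample η φ (xs i)) (star (normalizedSample η φ (xs i)))
        - (((1 - t) * M / (2 * m) : ℝ) : ℂ) • (1 : Matrix (Fin m) (Fin m) ℂ)).PosDef)
    (a : Fin m → ℂ) :
    ∑ k, ‖a k‖ ^ 2 ≤ 2 / (M * (1 - t)) * ∑ i, ‖∑ k, a k * η k (xs i)‖ ^ 2 := by
  have hmpos : (0 : ℝ) < m := by exact_mod_cast hm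
  have hMpos : (0 : ℝ) < M := by exact_mod_cast hM0
  have ht' : 0 < 1 - t := by linarith
  have h := hxs.posSemidef.dotProduct_mulVec_nonneg a
  have hS := star_dotProduct_sum_vecMulVec_mulVec Finset.univ
    (Matrix.of fun i k => star (normalizedSample η φ (xs i) k)) a
  have hstar : ∀ i, star ((Matrix.of fun i k => star (normalizedSample η φ (xs i) k)) i)
      = normalizedSample η φ (xs i) := fun i => by
    funext k
    exact star_star _
  simp only [hstar] at hS
  have hone : star a ⬝ᵥ a = ((∑ k, ‖a k‖ ^ 2 : ℝ) : ℂ) := by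
    simp [dotProduct, Complex.conj_mul']
  rw [sub_mulVec, dotProduct_sub, hS, smul_mulVec, one_mulVec, dotProduct_smul, hone, smul_eq_mul,
    ← Complex.ofReal_mul, ← Complex.ofReal_sub] at h
  have h' : (1 - t) * M / (2 * m) * ∑ k, ‖a k‖ ^ 2
      ≤ ∑ i, ‖((Matrix.of fun i k => star (normalizedSample η φ (xs i) k)) *ᵥ a) i‖ ^ 2 := by
    rw [← Complex.ofReal_zero] at h
    exact sub_nonneg.1 (Complex.real_le_real.1 h)
  have hterm : ∀ i, ‖((Matrix.of fun i k => star (normalizedSample η φ (xs i) k)) *ᵥ a) i‖ ^ 2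
      ≤ (m : ℝ)⁻¹ * ‖∑ k, a k * η k (xs i)‖ ^ 2 := fun i => by
    have hφ0 := half_le_density hφ (xs i)
    have hpos : 0 < 2 * m * φ (xs i) := by positivity
    have heq : ((Matrix.of fun i k => star (normalizedSample η φ (xs i) k)) *ᵥ a) i
        = ((√(2 * m * φ (xs i)))⁻¹ : ℝ) * ∑ k, a k * η k (xs i) := by
      simp only [mulVec, dotProduct, Matrix.of_apply, normalizedSample, RCLike.star_def, map_mul,
        Complex.conj_conj, Complex.conj_ofReal, Finset.mul_sum]
      exact Finset.sum_congr rfl fun k _ => by ring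
    rw [heq, norm_mul, mul_pow, Complex.norm_real, Real.norm_eq_abs, sq_abs, inv_pow,
      Real.sq_sqrt hpos.le]
    gcongr
    nlinarith
  have h2 := h'.trans (Finset.sum_le_sum fun i _ => hterm i)
  rw [← Finset.mul_sum] at h2
  rw [div_mul_eq_mul_div, le_div_iff₀ (by positivity)]
  have h3 := mul_le_mul_of_nonneg_left h2 (by positivity : (0 : ℝ) ≤ 2 * m)
  have e1 : 2 * m * ((1 - t) * M / (2 * m) * ∑ k, ‖a k‖ ^ 2)
      = (∑ k, ‖a k‖ ^ 2) * (M * (1 - t)) := by field_simp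
  have e2 : 2 * m * ((m : ℝ)⁻¹ * ∑ i, ‖∑ k, a k * η k (xs i)‖ ^ 2)
      = 2 * ∑ i, ‖∑ k, a k * η k (xs i)‖ ^ 2 := by field_simp
  rwa [e1, e2] at h3

variable [MeasurableSpace D] {ν : Measure D}

theorem integral_norm_sq_eq_sum_of_orthonormal [IsProbabilityMeasure ν]
    (hmeas : ∀ k, Measurable (η k))
    (hbdd : ∀ k, ∃ C : ℝ, ∀ x, ‖η k x‖ ≤ C)
    (horth : ∀ k j, ∫ x, η k x * (starRingEnd ℂ) (η j x) ∂ν = if k = j then 1 else 0)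
    (a : Fin m → ℂ) : ∫ x, ‖∑ k, a k * η k x‖ ^ 2 ∂ν = ∑ k, ‖a k‖ ^ 2 := by
  have hint : ∀ k j, Integrable (fun x => η k x * (starRingEnd ℂ) (η j x)) ν := fun k j => by
    obtain ⟨C, hC⟩ := hbdd k
    obtain ⟨C', hC'⟩ := hbdd j
    refine Integrable.of_bound ((hmeas k).mul
      (Complex.continuous_conj.measurable.comp (hmeas j))).aestronglyMeasurable (C * C')
      (Filter.Eventually.of_forall fun x => ?_)
    rw [norm_mul, RCLike.norm_conj]
    exact mul_le_mul (hC x) (hC' x) (norm_nonneg _) ((norm_nonneg _).trans (hC x))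
  have hexpand : ∀ x, ((‖∑ k, a k * η k x‖ ^ 2 : ℝ) : ℂ)
      = ∑ k, ∑ j, a k * (starRingEnd ℂ) (a j) * (η k x * (starRingEnd ℂ) (η j x)) := fun x => by
    push_cast
    rw [← Complex.mul_conj', map_sum, Finset.sum_mul_sum]
    refine Finset.sum_congr rfl fun k _ => Finset.sum_congr rfl fun j _ => ?_
    rw [map_mul]
    ring
  have hrow : ∀ k, Integrable (fun x => ∑ j, a k * (starRingEnd ℂ) (a j) *
      (η k x * (starRingEnd ℂ) (η j x))) ν :=
    fun k => integrable_finsetSum _ fun j _ => (hint k j).const_mul _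
  have h : ((∫ x, ‖∑ k, a k * η k x‖ ^ 2 ∂ν : ℝ) : ℂ) = ((∑ k, ‖a k‖ ^ 2 : ℝ) : ℂ) := by
    rw [← integral_complex_ofReal]
    simp only [hexpand]
    rw [integral_finsetSum _ fun k _ => hrow k]
    push_cast
    refine Finset.sum_congr rfl fun k _ => ?_
    rw [integral_finsetSum _ fun j _ => (hint k j).const_mul _]
    simp only [integral_const_mul, horth]
    simp [Complex.mul_conj']
  exact_mod_cast h

theorem measurable_normalizedSample (hmeas : ∀ k, Measurable (η k)) (hφm : Measurable φ)
    (k : Fin m) : Measurable fun x => normalizedSample η φ x k :=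
  (Complex.continuous_conj.measurable.comp (hmeas k)).mul
    (Complex.measurable_ofReal.comp (measurable_const.mul hφm).sqrt.inv)

theorem integral_normalizedSample {μ : Measure D} (hm : 0 < m)
    (horth : ∀ k j, ∫ x, η k x * (starRingEnd ℂ) (η j x) ∂ν = if k = j then 1 else 0)
    (hφm : Measurable φ) (hφ : ∀ x, φ x = 1 / 2 + 1 / (2 * m) * ∑ k, ‖η k x‖ ^ 2)
    (hμ : μ = ν.withDensity fun x => ENNReal.ofReal (φ x)) (i j : Fin m) :
    ∫ x, normalizedSample η φ x i * (starRingEnd ℂ) (normalizedSample η φ x j) ∂μ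
      = if i = j then ((2 * m : ℝ) : ℂ)⁻¹ else 0 := by
  have hmpos : (0 : ℝ) < m := by exact_mod_cast hm
  have hdens : (fun x => ENNReal.ofReal (φ x)) = fun x => ((φ x).toNNReal : ENNReal) := rfl
  rw [hμ, hdens, integral_withDensity_eq_integral_smul hφm.real_toNNReal]
  have hpoint : ∀ x, (φ x).toNNReal •
      (normalizedSample η φ x i * (starRingEnd ℂ) (normalizedSample η φ x j))
        = ((2 * m : ℝ) : ℂ)⁻¹ * (η j x * (starRingEnd ℂ) (η i x)) := fun x => by
    have hφ0 : 0 < φ x := lt_of_lt_of_le (by norm_num) (half_le_density hφ x)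
    have hsq : φ x * ((√(2 * m * φ x))⁻¹ * (√(2 * m * φ x))⁻¹) = (2 * m : ℝ)⁻¹ := by
      rw [← mul_inv, Real.mul_self_sqrt (by positivity)]
      field_simp
    have hsq' : (φ x : ℂ) * (((√(2 * m * φ x))⁻¹ : ℝ) * ((√(2 * m * φ x))⁻¹ : ℝ))
        = ((2 * m : ℝ) : ℂ)⁻¹ := by
      rw [← Complex.ofReal_inv, ← hsq]
      push_cast
      rfl
    rw [NNReal.smul_def, Real.coe_toNNReal _ hφ0.le, Complex.real_smul, ← hsq']
    simp only [normalizedSample, map_mul, Complex.conj_conj, Complex.conj_ofReal]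
    ring
  simp only [hpoint, integral_const_mul, horth, mul_ite, mul_one, mul_zero, eq_comm]

end Sampling

/-- Constructible unweighted Marcinkiewicz–Zygmund inequalities
(Theorem `theorem:finite`). -/
theorem stmt_17 (D : Type) [MeasurableSpace D] (ν : Measure D)
    [IsProbabilityMeasure ν]
    (m : ℕ) (hm : 10 ≤ m) (η : Fin m → D → ℂ)
    (hmeas : ∀ k, Measurable (η k))
    (hbdd : ∀ k, ∃ C : ℝ, ∀ x, ‖η k x‖ ≤ C)
    (horth : ∀ k j, ∫ x, η k x * (starRingEnd ℂ) (η j x) ∂ν =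
      if k = j then 1 else 0)
    (p t b : ℝ) (hp : 0 < p) (hp1 : p < 1) (ht : 0 < t) (ht1 : t < 1)
    (hb : 1 + 10 / (m : ℝ) ≤ b)
    (φ : D → ℝ) (hφ : ∀ x, φ x = 1 / 2 + 1 / (2 * m) * ∑ k, ‖η k x‖ ^ 2)
    (μ : Measure D) [IsProbabilityMeasure μ]
    (hμ : μ = ν.withDensity fun x => ENNReal.ofReal (φ x))
    (M : ℕ) (hM : 4 / t ^ 2 * m * Real.log (m / p) ≤ (M : ℝ))
    (hM2 : ⌈b * m⌉₊ ≤ M) :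
    ENNReal.ofReal (1 - p) <
      Measure.pi (fun _ : Fin M => μ)
        {xs : Fin M → D | ∃ (n : ℕ) (s : Fin n → Fin M),
          n ≤ ⌈b * m⌉₊ ∧ StrictMono s ∧
          ∀ a : Fin m → ℂ,
            (∫ x, ‖∑ k, a k * η k x‖ ^ 2 ∂ν) ≤
              2 / (M * (1 - t)) * ∑ i, ‖∑ k, a k * η k (xs i)‖ ^ 2 ∧
            2 / (M * (1 - t)) * ∑ i, ‖∑ k, a k * η k (xs i)‖ ^ 2 ≤
              432 * b ^ 3 / ((b - 1) ^ 3 * (1 - t)) *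
                ((1 / m) * ∑ i, ‖∑ k, a k * η k (xs (s i))‖ ^ 2)} := by
  have hm0 : 0 < m := by omega
  have : Nonempty (Fin m) := ⟨⟨0, hm0⟩⟩
  have hmpos : (0 : ℝ) < m := by exact_mod_cast hm0
  have hb1 : 1 < b := lt_of_lt_of_le (lt_add_of_pos_right 1 (by positivity)) hb
  have hM0 : 0 < M := (Nat.ceil_pos.2 (by positivity)).trans_le hM2
  have hφm : Measurable φ := by
    rw [funext hφ]
    exact measurable_const.add (measurable_const.mul
      (Finset.measurable_sum _ fun k _ => (hmeas k).norm.pow_const 2))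
  have hprob := lt_measure_pi_posDef (measurable_normalizedSample hmeas hφm)
    (sum_norm_sq_normalizedSample_le hm0 hφ)
    (by simpa only [Fintype.card_fin] using integral_normalizedSample hm0 horth hφm hφ hμ)
    hp hp1 ht ht1 hM0 (by simpa only [Fintype.card_fin] using hM)
  refine hprob.trans_le (measure_mono fun xs hxs => ?_)
  simp only [Set.mem_ofPred_eq, Fintype.card_fin] at hxs
  have hlow := sum_sq_le_of_posDef hm0 ht1 hφ hM0 hxs
  have hval : ∀ (a : Fin m → ℂ) (i : Fin M),
      (Matrix.of fun i k => η k (xs i)).mulVec a i = ∑ k, a k * η k (xs i) := fun a i => by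
    simp only [Matrix.mulVec, dotProduct, Matrix.of_apply, mul_comm]
  obtain ⟨n, s, hn, hs, hbound⟩ := exists_strictMono_sum_sq_lower_bound hm0
    (Matrix.of fun i k => η k (xs i)) hb1 ht1 hM2 (by simpa only [hval] using hlow)
  simp only [hval] at hbound
  refine ⟨n, s, hn, hs, fun a => ⟨?_, hbound a⟩⟩
  rw [integral_norm_sq_eq_sum_of_orthonormal hmeas hbdd horth]
  exact hlow a
end

section
/- Let $(D, \nu)$ be a probability space and let $V_m$ be an $m$-dimensional subspace of bounded measurable functions $D \to \mathbb{C}$ with $m \ge 10$. Let $b \ge 1 + \frac{10}{m}$, $t \in (0,1)$, and let $x^1, \dots, x^n \in D$ with $n \le \lceil bm \rceil$ be nodes satisfying the Marcinkiewicz–Zygmund inequality $\|g\|_{L_2(D,\nu)}^2 \le \frac{432\, b^3}{(b-1)^3 (1-t)} \cdot \frac{1}{m} \sum_{i=1}^n |g(x^i)|^2$ for all $g \in V_m$. Then there exists a constant $C > 0$, independent of $f$, $m$, $b$, $t$, $V_m$ and the nodes, such that for every bounded measurable $f : D \to \mathbb{C}$ and every $S f \in V_m$ minimizing $g \mapsto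 \sum_{i=1}^n |g(x^i) - f(x^i)|^2$ over $g \in V_m$: $\|f - S f\|_{L_2(D,\nu)}^2 \le \frac{C\, b^4}{(b-1)^3 (1-t)} \, e(f, V_m)_{\ell_\infty(D)}^2$, where $e(f, V_m)_{\ell_\infty(D)} := \inf_{g \in V_m} \sup_{x \in D} |f(x) - g(x)|$. -/
open MeasureTheory

/-- Squared form of the triangle inequality through an intermediate point. -/
lemma norm_sub_sq_le_two_mul_add (a b c : ℂ) :
    ‖a - c‖ ^ 2 ≤ 2 * ‖a - b‖ ^ 2 + 2 * ‖b - c‖ ^ 2 := by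
  have h := norm_sub_le_norm_sub_add_norm_sub a b c
  nlinarith [norm_nonneg (a - c), sq_nonneg (‖a - b‖ - ‖b - c‖)]

/-- The squared norm of a bounded measurable function is integrable for a finite measure. -/
lemma integrable_norm_sq_of_bounded {D : Type*} [MeasurableSpace D] {ν : Measure D}
    [IsFiniteMeasure ν] {h : D → ℂ} (hm : Measurable h) {B : ℝ} (hB : ∀ z, ‖h z‖ ≤ B) :
    Integrable (fun z => ‖h z‖ ^ 2) ν := by
  refine Integrable.of_bound (hm.norm.pow_const 2).aestronglyMeasurable (B ^ 2)
    (Filter.Eventually.of_forall fun z => ?_)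
  rw [Real.norm_of_nonneg (by positivity)]
  exact pow_le_pow_left₀ (norm_nonneg _) (hB z) 2

/-- If the sampled values control the `L²` norm of `g - s` with constant `A` and `s` fits `f`
at the nodes at least as well as `g`, the `L²` error of `s` is controlled by any uniform bound
on the error of `g`. -/
lemma integral_norm_sub_sq_le_of_sampled {D : Type*} [MeasurableSpace D] {ν : Measure D}
    [IsProbabilityMeasure ν] {n : ℕ} (x : Fin n → D) {f g s : D → ℂ} {A E : ℝ} (hA : 0 ≤ A)
    (hE : ∀ z, ‖f z - g z‖ ≤ E)
    (hfg : Integrable (fun z => ‖f z - g z‖ ^ 2) ν)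
    (hgs : Integrable (fun z => ‖g z - s z‖ ^ 2) ν)
    (hfs : Integrable (fun z => ‖f z - s z‖ ^ 2) ν)
    (hMZ : ∫ z, ‖g z - s z‖ ^ 2 ∂ν ≤ A * ∑ i, ‖g (x i) - s (x i)‖ ^ 2)
    (hmin : ∑ i, ‖s (x i) - f (x i)‖ ^ 2 ≤ ∑ i, ‖g (x i) - f (x i)‖ ^ 2) :
    ∫ z, ‖f z - s z‖ ^ 2 ∂ν ≤ (2 + 8 * A * n) * E ^ 2 := by
  have hEsq (z : D) : ‖f z - g z‖ ^ 2 ≤ E ^ 2 := pow_le_pow_left₀ (norm_nonneg _) (hE z) 2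
  have htri : ∫ z, ‖f z - s z‖ ^ 2 ∂ν
      ≤ 2 * ∫ z, ‖f z - g z‖ ^ 2 ∂ν + 2 * ∫ z, ‖g z - s z‖ ^ 2 ∂ν := by
    rw [← integral_const_mul, ← integral_const_mul,
      ← integral_add (hfg.const_mul 2) (hgs.const_mul 2)]
    exact integral_mono hfs ((hfg.const_mul 2).add (hgs.const_mul 2))
      fun z => norm_sub_sq_le_two_mul_add _ _ _
  have hunif : ∫ z, ‖f z - g z‖ ^ 2 ∂ν ≤ E ^ 2 := by
    simpa using integral_mono hfg (integrable_const (E ^ 2)) hEsq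
  have hnodes : ∑ i, ‖g (x i) - f (x i)‖ ^ 2 ≤ n * E ^ 2 := by
    calc ∑ i, ‖g (x i) - f (x i)‖ ^ 2 ≤ ∑ _i : Fin n, E ^ 2 :=
          Finset.sum_le_sum fun i _ => by rw [norm_sub_rev]; exact hEsq _
      _ = n * E ^ 2 := by simp
  have hsum : ∑ i, ‖g (x i) - s (x i)‖ ^ 2 ≤ 4 * (n * E ^ 2) := by
    calc ∑ i, ‖g (x i) - s (x i)‖ ^ 2
        ≤ ∑ i, (2 * ‖g (x i) - f (x i)‖ ^ 2 + 2 * ‖s (x i) - f (x i)‖ ^ 2) :=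
          Finset.sum_le_sum fun i _ => by
            rw [norm_sub_rev (s (x i))]; exact norm_sub_sq_le_two_mul_add _ _ _
      _ = 2 * ∑ i, ‖g (x i) - f (x i)‖ ^ 2 + 2 * ∑ i, ‖s (x i) - f (x i)‖ ^ 2 := by
          rw [Finset.sum_add_distrib, Finset.mul_sum, Finset.mul_sum]
      _ ≤ 4 * (n * E ^ 2) := by linarith
  have := mul_le_mul_of_nonneg_left hsum hA
  linarith

/-- A quadratic bound valid for every member of a nonnegative family passes to the infimum. -/
lemma le_mul_ciInf_sq {ι : Type*} [Nonempty ι] {I K : ℝ} (hK : 0 < K) {u : ι → ℝ}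
    (hu : ∀ i, 0 ≤ u i) (h : ∀ i, I ≤ K * u i ^ 2) : I ≤ K * (⨅ i, u i) ^ 2 := by
  have hinf : √(I / K) ≤ ⨅ i, u i := le_ciInf fun i =>
    Real.sqrt_le_iff.mpr ⟨hu i, by rw [div_le_iff₀ hK, mul_comm]; exact h i⟩
  have := (Real.sqrt_le_iff.mp hinf).2
  rwa [div_le_iff₀ hK, mul_comm] at this

/-- Plain least squares recovery from Marcinkiewicz–Zygmund nodes
(Theorem `thm:sampl`). -/
theorem stmt_18 (D : Type) [MeasurableSpace D] (ν : Measure D)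
    [IsProbabilityMeasure ν] :
    ∃ C : ℝ, 0 < C ∧
      ∀ (m : ℕ), 10 ≤ m →
      ∀ V : Submodule ℂ (D → ℂ),
        (∀ g ∈ V, Measurable g ∧ ∃ Cg : ℝ, ∀ x, ‖g x‖ ≤ Cg) →
        Module.finrank ℂ V = m →
      ∀ b t : ℝ, 1 + 10 / (m : ℝ) ≤ b → 0 < t → t < 1 →
      ∀ (n : ℕ) (x : Fin n → D), n ≤ ⌈b * m⌉₊ →
        (∀ g ∈ V, ∫ z, ‖g z‖ ^ 2 ∂ν ≤
          432 * b ^ 3 / ((b - 1) ^ 3 * (1 - t)) * ((1 / m) * ∑ i, ‖g (x i)‖ ^ 2)) →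
      ∀ f : D → ℂ, Measurable f → (∃ Cf : ℝ, ∀ z, ‖f z‖ ≤ Cf) →
      ∀ Sf, Sf ∈ V →
        (∀ g ∈ V, ∑ i, ‖Sf (x i) - f (x i)‖ ^ 2 ≤ ∑ i, ‖g (x i) - f (x i)‖ ^ 2) →
        ∫ z, ‖f z - Sf z‖ ^ 2 ∂ν ≤
          C * b ^ 4 / ((b - 1) ^ 3 * (1 - t)) *
            (⨅ g : V, ⨆ z : D, ‖f z - (g : D → ℂ) z‖) ^ 2 := by
  refine ⟨8000, by norm_num, ?_⟩
  intro m hm V hV _ b t hb _ ht1 n x hn hMZ f hf hfb Sf hSf hmin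
  obtain ⟨Cf, hCf⟩ := hfb
  have hm0 : (10 : ℝ) ≤ m := by exact_mod_cast hm
  have hb1 : 1 < b := by
    have : 0 < 10 / (m : ℝ) := by positivity
    linarith
  have hden : 0 < (b - 1) ^ 3 * (1 - t) := mul_pos (pow_pos (by linarith) 3) (by linarith)
  have hn' : (n : ℝ) ≤ 2 * (b * m) := by
    have h1 : (n : ℝ) ≤ (⌈b * m⌉₊ : ℝ) := by exact_mod_cast hn
    have h2 := Nat.ceil_lt_add_one (a := b * m) (by positivity)
    nlinarith
  have hK : 0 < 8000 * b ^ 4 / ((b - 1) ^ 3 * (1 - t)) := by positivity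
  refine le_mul_ciInf_sq hK (fun g => Real.iSup_nonneg fun z => norm_nonneg _) ?_
  rintro ⟨g, hg⟩
  obtain ⟨hgm, Cg, hCg⟩ := hV g hg
  obtain ⟨hSm, CS, hCS⟩ := hV Sf hSf
  have hbound {p q : D → ℂ} {P Q : ℝ} (hp : ∀ z, ‖p z‖ ≤ P) (hq : ∀ z, ‖q z‖ ≤ Q) (z : D) :
      ‖p z - q z‖ ≤ P + Q := (norm_sub_le _ _).trans (add_le_add (hp z) (hq z))
  have hsup (z : D) : ‖f z - g z‖ ≤ ⨆ z : D, ‖f z - g z‖ :=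
    le_ciSup (f := fun z => ‖f z - g z‖)
      ⟨Cf + Cg, by rintro _ ⟨z, rfl⟩; exact hbound hCf hCg z⟩ z
  have hest := integral_norm_sub_sq_le_of_sampled (ν := ν) x
    (A := 432 * b ^ 3 / ((b - 1) ^ 3 * (1 - t)) * (1 / m)) (by positivity) hsup
    (integrable_norm_sq_of_bounded (hf.sub hgm) (hbound hCf hCg))
    (integrable_norm_sq_of_bounded (hgm.sub hSm) (hbound hCg hCS))
    (integrable_norm_sq_of_bounded (hf.sub hSm) (hbound hCf hCS))
    (by rw [mul_assoc]; exact hMZ (g - Sf) (V.sub_mem hg hSf)) (hmin g hg)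
  refine hest.trans (mul_le_mul_of_nonneg_right ?_ (sq_nonneg _))
  have hone : 1 ≤ b ^ 4 / ((b - 1) ^ 3 * (1 - t)) := by
    rw [one_le_div hden]
    calc (b - 1) ^ 3 * (1 - t) ≤ b ^ 3 * 1 := by
          have h : (b - 1) ^ 3 ≤ b ^ 3 := pow_le_pow_left₀ (by linarith) (by linarith) 3
          exact mul_le_mul h (by linarith) (by linarith) (by positivity)
      _ ≤ b ^ 4 := by
          rw [mul_one]; exact pow_le_pow_right₀ hb1.le (by norm_num)
  have hsample : 8 * (432 * b ^ 3 / ((b - 1) ^ 3 * (1 - t)) * (1 / m)) * n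
      ≤ 6912 * (b ^ 4 / ((b - 1) ^ 3 * (1 - t))) := by
    calc 8 * (432 * b ^ 3 / ((b - 1) ^ 3 * (1 - t)) * (1 / m)) * n
        ≤ 8 * (432 * b ^ 3 / ((b - 1) ^ 3 * (1 - t)) * (1 / m)) * (2 * (b * m)) := by
          gcongr
      _ = 6912 * (b ^ 4 / ((b - 1) ^ 3 * (1 - t))) := by
          field_simp
          ring
  rw [mul_div_assoc 8000]
  linarith
end
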